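/- arXiv:1910.12484 — 2 statements merged into one kernel-verified Lean document; each statement's English description precedes it below -/
import Mathlib

section
/- Let n ≥ 3 be odd and let m ≥ 3 be an integer with m ≠ n. Then the systems of sets of lengths of the monoids of product-one sequences over the dihedral groups D_{2n} and D_{2m} are distinct: L(D_{2n}) ≠ L(D_{2m}). -/
namespace ProductOne

open scoped Classical

variable {G : Type*} [Group G]

/-- `S` is a product-one sequence over `G`: its terms can be ordered with product `1`. -/
def IsProductOne (S : Multiset G) : Prop :=
  ∃ l : List G, (l : Multiset G) = S ∧ l.prod = 1

/-- `S` is an atom (a minimal product-one sequence): it is a nontrivial product-one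
sequence that is not the concatenation of two nontrivial product-one sequences. -/
def IsAtomSeq (S : Multiset G) : Prop :=
  S ≠ 0 ∧ IsProductOne S ∧
    ∀ A B : Multiset G, S = A + B → IsProductOne A → IsProductOne B → A = 0 ∨ B = 0

/-- `S` is a sequence over the subset `G₀ ⊆ G`. -/
def SeqOn (G₀ : Set G) (S : Multiset G) : Prop := ∀ g ∈ S, g ∈ G₀

/-- `S` is an atom of the monoid `B(G₀)` of product-one sequences over `G₀`. -/
def IsAtomSeqOn (G₀ : Set G) (S : Multiset G) : Prop := SeqOn G₀ S ∧ IsAtomSeq S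

/-- The set of lengths `L(A)` of factorizations of `A` into atoms over `G₀`. -/
def lengthsOn (G₀ : Set G) (A : Multiset G) : Set ℕ :=
  {k | ∃ f : Multiset (Multiset G), Multiset.card f = k ∧
        (∀ U ∈ f, IsAtomSeqOn G₀ U) ∧ f.sum = A}

/-- The set of lengths `L(A)` over the whole group. -/
def lengths (A : Multiset G) : Set ℕ := lengthsOn Set.univ A

/-- The set of distances of a set `L ⊆ ℕ`. -/
def distancesOf (L : Set ℕ) : Set ℕ :=
  {d | 0 < d ∧ ∃ a, a ∈ L ∧ a + d ∈ L ∧ ∀ b ∈ L, ¬(a < b ∧ b < a + d)}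

/-- The set of distances `Δ(G₀)` of the monoid `B(G₀)`. -/
def DeltaOn (G₀ : Set G) : Set ℕ :=
  {d | ∃ A : Multiset G, SeqOn G₀ A ∧ IsProductOne A ∧ d ∈ distancesOf (lengthsOn G₀ A)}

/-- The set of distances `Δ(G)` of `B(G)`. -/
def Delta (G : Type*) [Group G] : Set ℕ := DeltaOn (Set.univ : Set G)

/-- The large Davenport constant of `G₀`: maximal length of an atom of `B(G₀)`. -/
noncomputable def DavenportOn (G₀ : Set G) : ℕ :=
  sSup {k | ∃ S : Multiset G, IsAtomSeqOn G₀ S ∧ Multiset.card S = k}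

/-- The large Davenport constant `D(G)`. -/
noncomputable def Davenport (G : Type*) [Group G] : ℕ :=
  DavenportOn (Set.univ : Set G)

/-- The small Davenport constant `d(G₀)`: maximal length of a product-one free
sequence over `G₀`. -/
noncomputable def smallDavenportOn (G₀ : Set G) : ℕ :=
  sSup {k | ∃ S : Multiset G, SeqOn G₀ S ∧ Multiset.card S = k ∧
        ∀ T : Multiset G, T ≤ S → T ≠ 0 → ¬IsProductOne T}

/-- `Δ*(G) = {min Δ(G₀) : G₀ ⊆ G with Δ(G₀) ≠ ∅}`. -/
def DeltaStar (G : Type*) [Group G] : Set ℕ :=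
  {d | ∃ G₀ : Set G, (DeltaOn G₀).Nonempty ∧ d = sInf (DeltaOn G₀)}

/-- The elasticity `ρ(L) = max L / min L` of a set of lengths (with the set of
positive elements used, and `ρ = 1` if there are none). -/
noncomputable def elasticity (L : Set ℕ) : ℚ :=
  if (L ∩ {k | 0 < k}).Nonempty then
    ((sSup (L ∩ {k | 0 < k}) : ℕ) : ℚ) / ((sInf (L ∩ {k | 0 < k}) : ℕ) : ℚ)
  else 1

/-- The elasticity `ρ(G₀)` of the monoid `B(G₀)`. -/
noncomputable def rhoOn (G₀ : Set G) : ℝ :=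
  sSup {x : ℝ | ∃ A : Multiset G, SeqOn G₀ A ∧ IsProductOne A ∧
    x = (elasticity (lengthsOn G₀ A) : ℝ)}

/-- `Δ*_ρ(G) = {min Δ(G₀) : G₀ ⊆ G with ρ(G₀) = D(G)/2}`. -/
noncomputable def DeltaRhoStar (G : Type*) [Group G] : Set ℕ :=
  {d | ∃ G₀ : Set G, rhoOn G₀ = (Davenport G : ℝ) / 2 ∧ d = sInf (DeltaOn G₀)}

/-- Divisibility in the monoid `B(G)`. -/
def BDvd (A S : Multiset G) : Prop :=
  ∃ C : Multiset G, IsProductOne C ∧ S = A + C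

/-- The `ω`-invariant `ω(B(G), A)`. -/
noncomputable def omegaAt (A : Multiset G) : ℕ∞ :=
  sInf {N : ℕ∞ | ∀ f : Multiset (Multiset G),
    (∀ B ∈ f, IsProductOne B) → BDvd A f.sum →
    ∃ t ≤ f, (Multiset.card t : ℕ∞) ≤ N ∧ BDvd A t.sum}

/-- `ω(G) = sup {ω(B(G), U) : U an atom of B(G)}`. -/
noncomputable def omegaInv (G : Type*) [Group G] : ℕ∞ :=
  ⨆ U ∈ {U : Multiset G | IsAtomSeq U}, omegaAt U

/-- `z` is a factorization of `A` into atoms. -/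
def IsFactorization (A : Multiset G) (z : Multiset (Multiset G)) : Prop :=
  (∀ U ∈ z, IsAtomSeq U) ∧ z.sum = A

/-- The distance between two factorizations. -/
noncomputable def factDist (z z' : Multiset (Multiset G)) : ℕ :=
  letI := Classical.decEq (Multiset G)
  max (Multiset.card (z - z')) (Multiset.card (z' - z))

/-- The catenary degree `c(A)`. -/
noncomputable def catenaryAt (A : Multiset G) : ℕ∞ :=
  sInf {N : ℕ∞ | ∀ z z' : Multiset (Multiset G),
    IsFactorization A z → IsFactorization A z' →
    Relation.ReflTransGen
      (fun x y => IsFactorization A y ∧ (factDist x y : ℕ∞) ≤ N) z z'}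

/-- The set of positive catenary degrees `Ca(G)`. -/
noncomputable def CatenarySet (G : Type*) [Group G] : Set ℕ∞ :=
  {c | ∃ A : Multiset G, IsProductOne A ∧ catenaryAt A = c ∧ 0 < c}

/-- The catenary degree `c(G)` of `B(G)`. -/
noncomputable def catenaryDegree (G : Type*) [Group G] : ℕ∞ :=
  ⨆ A ∈ {A : Multiset G | IsProductOne A}, catenaryAt A

/-- The cross number `k(S)` of a sequence. -/
noncomputable def crossNumber (S : Multiset G) : ℚ :=
  (S.map fun g => (1 : ℚ) / (orderOf g : ℚ)).sum

/-- The system of sets of lengths `L(G)`. -/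
def LSystem (G : Type*) [Group G] : Set (Set ℕ) :=
  {L | ∃ A : Multiset G, IsProductOne A ∧ L = lengths A}

/-- The set of products `π(S)` of all orderings of the terms of `S`. -/
def piSet (S : Multiset G) : Set G :=
  {g | ∃ l : List G, (l : Multiset G) = S ∧ l.prod = g}

/-- The sumset `{x₁, -x₁} + ⋯ + {x_s, -x_s}` for a sequence `a = x₁ ⋯ x_s`. -/
def signedSums {α : Type*} [AddCommGroup α] (a : Multiset α) : Set α :=
  {z | ∃ t ≤ a, z = t.sum + t.sum - a.sum}

/-- `Σ_k(T)`: the set of sums of `k`-term subsequences of `T`. -/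
def subseqSums {α : Type*} [AddCommMonoid α] (k : ℕ) (T : Multiset α) : Set α :=
  {z | ∃ t ≤ T, Multiset.card t = k ∧ t.sum = z}

/-- The subsequence `S_X` of all terms of `S` lying in `X`. -/
noncomputable def restrictTo (X : Set G) (S : Multiset G) : Multiset G :=
  letI := Classical.decPred fun g => g ∈ X
  S.filter fun g => g ∈ X

/-- The maximum multiplicity `h(S)` of a term of `S`. -/
noncomputable def maxMultiplicity {α : Type*} (S : Multiset α) : ℕ :=
  letI := Classical.decEq α
  S.toFinset.sup S.count

end ProductOne

namespace ProductOne

section Factorizations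

variable {G : Type*} [Group G]

theorem isProductOne_zero : IsProductOne (0 : Multiset G) := ⟨[], rfl, rfl⟩

theorem IsProductOne.add {A B : Multiset G} (hA : IsProductOne A) (hB : IsProductOne B) :
    IsProductOne (A + B) := by
  obtain ⟨l, rfl, hl⟩ := hA
  obtain ⟨l', rfl, hl'⟩ := hB
  exact ⟨l ++ l', by simp, by simp [hl, hl']⟩

theorem isProductOne_sum {f : Multiset (Multiset G)} (hf : ∀ U ∈ f, IsProductOne U) :
    IsProductOne f.sum := by
  induction f using Multiset.induction_on with
  | empty => exact isProductOne_zero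
  | cons U f ih =>
    rw [Multiset.sum_cons]
    exact (hf U (by simp)).add (ih fun V hV => hf V (by simp [hV]))

theorem isProductOne_map_inv {A : Multiset G} (hA : IsProductOne A) :
    IsProductOne (A.map (·⁻¹)) := by
  obtain ⟨l, rfl, hl⟩ := hA
  refine ⟨(l.map (·⁻¹)).reverse, by simp, ?_⟩
  rw [← List.prod_inv_reverse, hl, inv_one]

theorem map_inv_map_inv (A : Multiset G) : (A.map (·⁻¹)).map (·⁻¹) = A := by
  simp [Multiset.map_map]

theorem IsAtomSeq.map_inv {U : Multiset G} (hU : IsAtomSeq U) : IsAtomSeq (U.map (·⁻¹)) := by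
  refine ⟨by simpa using hU.1, isProductOne_map_inv hU.2.1, fun A B hAB hA hB => ?_⟩
  have h := hU.2.2 (A.map (·⁻¹)) (B.map (·⁻¹))
    (by rw [← Multiset.map_add, ← hAB, map_inv_map_inv])
    (isProductOne_map_inv hA) (isProductOne_map_inv hB)
  simpa using h

theorem eq_one_of_isProductOne_singleton {g : G} (h : IsProductOne ({g} : Multiset G)) :
    g = 1 := by
  obtain ⟨l, hl, hp⟩ := h
  rw [Multiset.coe_eq_singleton] at hl
  simpa [hl] using hp

theorem isAtomSeq_pair {g : G} (hg : g ≠ 1) : IsAtomSeq ({g, g⁻¹} : Multiset G) := by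
  refine ⟨by simp, ⟨[g, g⁻¹], rfl, by simp⟩, fun A B hAB hA hB => ?_⟩
  by_contra! hne
  have hcard : Multiset.card A + Multiset.card B = 2 := by
    rw [← Multiset.card_add, ← hAB]; rfl
  have hA0 := Multiset.card_pos.2 hne.1
  have hB0 := Multiset.card_pos.2 hne.2
  obtain ⟨a, rfl⟩ := Multiset.card_eq_one.1 (show Multiset.card A = 1 by omega)
  obtain ⟨b, rfl⟩ := Multiset.card_eq_one.1 (show Multiset.card B = 1 by omega)
  have hmem : g ∈ ({a} + {b} : Multiset G) := by rw [← hAB]; simp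
  rw [eq_one_of_isProductOne_singleton hA, eq_one_of_isProductOne_singleton hB] at hmem
  simp at hmem
  exact hg hmem

/-- The prefix products of an ordering of an atom with product one are pairwise distinct. -/
theorem IsAtomSeq.card_le [Finite G] {U : Multiset G} (hU : IsAtomSeq U) :
    Multiset.card U ≤ Nat.card G := by
  obtain ⟨-, ⟨l, rfl, hl⟩, hmin⟩ := hU
  have key : ∀ i j : ℕ, i < j → j < l.length → (l.take i).prod ≠ (l.take j).prod := by
    intro i j hij hj heq
    have hsplit : l.take j = l.take i ++ (l.take j).drop i := by
      conv_lhs => rw [← List.take_append_drop i (l.take j)]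
      rw [List.take_take, min_eq_left hij.le]
    have hl' : l = l.take i ++ (l.take j).drop i ++ l.drop j := by
      rw [← hsplit, List.take_append_drop]
    have hmid : ((l.take j).drop i).prod = 1 := by
      have h := congrArg List.prod hsplit
      rw [List.prod_append, ← heq] at h
      simpa using h
    have hrest : (l.take i ++ l.drop j).prod = 1 := by
      rw [List.prod_append, heq, ← List.prod_append, List.take_append_drop, hl]
    rcases hmin ((l.take j).drop i : List G) (l.take i ++ l.drop j : List G)
      (by
        conv_lhs => rw [hl']
        rw [← Multiset.coe_add, ← Multiset.coe_add, ← Multiset.coe_add]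
        abel) ⟨_, rfl, hmid⟩ ⟨_, rfl, hrest⟩ with h | h
    · have := congrArg Multiset.card h
      simp at this
      omega
    · have := congrArg Multiset.card h
      simp at this
      omega
  have hinj : Function.Injective fun i : Fin l.length => (l.take i).prod := by
    intro i j hij
    rcases lt_trichotomy i j with h | h | h
    · exact absurd hij (key i j h j.2)
    · exact h
    · exact absurd hij.symm (key j i h i.2)
  simpa using Nat.card_le_card_of_injective _ hinj

theorem IsAtomSeq.eq_singleton_one {U : Multiset G} (hU : IsAtomSeq U) (h1 : (1 : G) ∈ U) :
    U = {1} := by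
  obtain ⟨-, ⟨l, rfl, hl⟩, hmin⟩ := hU
  obtain ⟨s, t, rfl⟩ := List.append_of_mem (Multiset.mem_coe.1 h1)
  have hrest : ((s ++ t : List G) : Multiset G) = 0 := by
    refine (hmin {1} (s ++ t : List G) ?_ ⟨[1], rfl, by simp⟩ ⟨_, rfl, by simpa using hl⟩).resolve_left
      (by simp)
    rw [← Multiset.coe_add, ← Multiset.coe_add, ← Multiset.cons_coe, ← Multiset.singleton_add]
    abel
  simp at hrest
  simp [hrest.1, hrest.2]

theorem IsAtomSeq.card_factorization {U : Multiset G} (hU : IsAtomSeq U)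
    {f : Multiset (Multiset G)} (hf : ∀ W ∈ f, IsAtomSeq W) (hsum : f.sum = U) :
    Multiset.card f = 1 := by
  induction f using Multiset.induction_on with
  | empty => exact absurd hsum.symm hU.1
  | cons W f _ =>
    rw [Multiset.sum_cons] at hsum
    have h0 : f.sum = 0 :=
      (hU.2.2 W f.sum hsum.symm (hf W (by simp)).2.1
        (isProductOne_sum fun V hV => (hf V (by simp [hV])).2.1)).resolve_left (hf W (by simp)).1
    rcases f.empty_or_exists_mem with rfl | ⟨V, hV⟩
    · rfl
    · exact absurd (Multiset.le_zero.1 (h0 ▸ Multiset.le_sum_of_mem hV)) (hf V (by simp [hV])).1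

theorem mem_lengths_iff {A : Multiset G} {k : ℕ} :
    k ∈ lengths A ↔ ∃ f : Multiset (Multiset G), Multiset.card f = k ∧
      (∀ U ∈ f, IsAtomSeq U) ∧ f.sum = A := by
  simp [lengths, lengthsOn, IsAtomSeqOn, SeqOn]

theorem isProductOne_of_mem_lengths {A : Multiset G} {k : ℕ} (h : k ∈ lengths A) :
    IsProductOne A := by
  obtain ⟨f, -, hf, rfl⟩ := mem_lengths_iff.1 h
  exact isProductOne_sum fun U hU => (hf U hU).2.1

/-- If `A` is a product of two atoms and of `k > 2` atoms, then the identity does not occur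
in `A`, so all atoms of a factorization of length `k` have at least two terms. -/
theorem exists_atoms_of_two_mem_lengths {A : Multiset G} {k : ℕ} (h2 : 2 ∈ lengths A)
    (hk : k ∈ lengths A) (hlt : 2 < k) :
    ∃ U V : Multiset G, IsAtomSeq U ∧ IsAtomSeq V ∧ A = U + V ∧
      ∃ f : Multiset (Multiset G), Multiset.card f = k ∧ (∀ W ∈ f, IsAtomSeq W) ∧ f.sum = A ∧
        ∀ W ∈ f, 2 ≤ Multiset.card W := by
  obtain ⟨e, he, hatom, rfl⟩ := mem_lengths_iff.1 h2
  obtain ⟨U, V, rfl⟩ := Multiset.card_eq_two.1 he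
  obtain ⟨f, hf, hfatom, hsum⟩ := mem_lengths_iff.1 hk
  have hU : IsAtomSeq U := hatom U (by simp)
  have hV : IsAtomSeq V := hatom V (by simp)
  have hUV : ({U, V} : Multiset (Multiset G)).sum = U + V := by simp
  rw [hUV] at hsum ⊢
  refine ⟨U, V, hU, hV, rfl, f, hf, hfatom, hsum, fun W hW => ?_⟩
  by_contra! hcard
  have hWatom := hfatom W hW
  have hpos := Multiset.card_pos.2 hWatom.1
  obtain ⟨g, rfl⟩ := Multiset.card_eq_one.1 (show Multiset.card W = 1 by omega)
  obtain rfl := eq_one_of_isProductOne_singleton hWatom.2.1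
  obtain ⟨f', rfl⟩ := Multiset.exists_cons_of_mem hW
  rw [Multiset.sum_cons] at hsum
  rw [Multiset.card_cons] at hf
  have hf' : ∀ W ∈ f', IsAtomSeq W := fun W hW => hfatom W (by simp [hW])
  have hmem : (1 : G) ∈ U + V := by rw [← hsum]; simp
  rcases Multiset.mem_add.1 hmem with h | h
  · rw [hU.eq_singleton_one h] at hsum
    have := hV.card_factorization hf' (add_left_cancel hsum)
    omega
  · rw [hV.eq_singleton_one h, add_comm U] at hsum
    have := hU.card_factorization hf' (add_left_cancel hsum)
    omega

theorem card_multiset_sum {α : Type*} (f : Multiset (Multiset α)) :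
    Multiset.card f.sum = (f.map Multiset.card).sum := by
  induction f using Multiset.induction_on with
  | empty => rfl
  | cons U f ih => simp [ih]

theorem two_mul_card_le_card_sum {α : Type*} {f : Multiset (Multiset α)}
    (hf : ∀ W ∈ f, 2 ≤ Multiset.card W) : 2 * Multiset.card f ≤ Multiset.card f.sum := by
  have h := Multiset.card_nsmul_le_sum (s := f.map Multiset.card) (a := 2) (by simpa using hf)
  rw [← card_multiset_sum, Multiset.card_map, smul_eq_mul] at h
  omega

theorem le_card_of_mem_lengths [Finite G] {A : Multiset G} {k : ℕ} (h2 : 2 ∈ lengths A)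
    (hk : k ∈ lengths A) (hlt : 2 < k) : k ≤ Nat.card G := by
  obtain ⟨U, V, hU, hV, rfl, f, rfl, -, hsum, hcard⟩ := exists_atoms_of_two_mem_lengths h2 hk hlt
  have h := two_mul_card_le_card_sum hcard
  rw [hsum, Multiset.card_add] at h
  have := hU.card_le
  have := hV.card_le
  omega

theorem two_mem_lengths_add {U V : Multiset G} (hU : IsAtomSeq U) (hV : IsAtomSeq V) :
    2 ∈ lengths (U + V) :=
  mem_lengths_iff.2 ⟨{U, V}, rfl, by simp [hU, hV], by simp⟩

theorem sum_map_pair_inv (U : Multiset G) :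
    (U.map fun g => ({g, g⁻¹} : Multiset G)).sum = U + U.map (·⁻¹) := by
  induction U using Multiset.induction_on with
  | empty => rfl
  | cons g U ih =>
    simp only [Multiset.map_cons, Multiset.sum_cons, ih]
    simp only [Multiset.insert_eq_cons, ← Multiset.singleton_add]
    abel

theorem card_mem_lengths_add_inv {U : Multiset G} (h1 : (1 : G) ∉ U) :
    Multiset.card U ∈ lengths (U + U.map (·⁻¹)) := by
  refine mem_lengths_iff.2 ⟨U.map fun g => {g, g⁻¹}, by simp, fun W hW => ?_,
    sum_map_pair_inv U⟩
  obtain ⟨g, hg, rfl⟩ := Multiset.mem_map.1 hW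
  exact isAtomSeq_pair fun h => h1 (h ▸ hg)

end Factorizations

section SignedValues

variable {α : Type*} [AddCommGroup α]

/-- The sums of the terms of `R` with arbitrary signs. -/
def signedValues (R : Multiset α) : Set α :=
  {x | ∃ P N : Multiset α, P + N = R ∧ x = P.sum - N.sum}

/-- The sums of the terms of `T` with signs such that as many terms carry the sign `+` as
carry the sign `-`. -/
def balancedValues (T : Multiset α) : Set α :=
  {x | ∃ P N : Multiset α, P + N = T ∧ Multiset.card P = Multiset.card N ∧ x = P.sum - N.sum}

end SignedValues

section Dihedral

open DihedralGroup

variable {m : ℕ}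

/-- The sequence over the dihedral group with rotations `R` and reflections `T`. -/
def dihedralSeq (R T : Multiset (ZMod m)) : Multiset (DihedralGroup m) :=
  R.map r + T.map sr

theorem exists_eq_dihedralSeq (S : Multiset (DihedralGroup m)) :
    ∃ R T : Multiset (ZMod m), S = dihedralSeq R T := by
  induction S using Multiset.induction_on with
  | empty => exact ⟨0, 0, rfl⟩
  | cons g S ih =>
    obtain ⟨R, T, rfl⟩ := ih
    cases g with
    | r i => exact ⟨i ::ₘ R, T, by simp [dihedralSeq]⟩
    | sr i => exact ⟨R, i ::ₘ T, by simp [dihedralSeq]⟩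

theorem dihedralSeq_add (R R' T T' : Multiset (ZMod m)) :
    dihedralSeq (R + R') (T + T') = dihedralSeq R T + dihedralSeq R' T' := by
  simp only [dihedralSeq, Multiset.map_add]
  abel

@[simp]
theorem card_dihedralSeq (R T : Multiset (ZMod m)) :
    Multiset.card (dihedralSeq R T) = Multiset.card R + Multiset.card T := by
  simp [dihedralSeq]

theorem dihedralSeq_eq_zero {R T : Multiset (ZMod m)} :
    dihedralSeq R T = 0 ↔ R = 0 ∧ T = 0 := by
  simp [dihedralSeq]

/-- The exponent of a rotation. -/
def rotationExponent : DihedralGroup m → Option (ZMod m)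
  | r i => some i
  | sr _ => none

/-- The exponent of a reflection. -/
def reflectionExponent : DihedralGroup m → Option (ZMod m)
  | r _ => none
  | sr i => some i

theorem filterMap_rotationExponent (R T : Multiset (ZMod m)) :
    (dihedralSeq R T).filterMap rotationExponent = R := by
  induction R using Multiset.induction_on with
  | empty =>
    induction T using Multiset.induction_on with
    | empty => rfl
    | cons t T ih =>
      rw [dihedralSeq, Multiset.map_zero, zero_add, Multiset.map_cons,
        Multiset.filterMap_cons_none _ _ rfl]
      simpa [dihedralSeq] using ih
  | cons x R ih =>
    rw [dihedralSeq, Multiset.map_cons, Multiset.cons_add,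
      Multiset.filterMap_cons_some rotationExponent (r x) _ (b := x) rfl]
    exact congrArg _ ih

theorem filterMap_reflectionExponent (R T : Multiset (ZMod m)) :
    (dihedralSeq R T).filterMap reflectionExponent = T := by
  induction R using Multiset.induction_on with
  | empty =>
    induction T using Multiset.induction_on with
    | empty => rfl
    | cons t T ih =>
      rw [dihedralSeq, Multiset.map_zero, zero_add, Multiset.map_cons,
        Multiset.filterMap_cons_some reflectionExponent (sr t) _ (b := t) rfl]
      exact congrArg _ (by simpa [dihedralSeq] using ih)
  | cons x R ih =>
    rw [dihedralSeq, Multiset.map_cons, Multiset.cons_add, Multiset.filterMap_cons_none _ _ rfl]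
    exact ih

theorem dihedralSeq_inj {R R' T T' : Multiset (ZMod m)} :
    dihedralSeq R T = dihedralSeq R' T' ↔ R = R' ∧ T = T' := by
  refine ⟨fun h => ⟨?_, ?_⟩, fun h => by rw [h.1, h.2]⟩
  · rw [← filterMap_rotationExponent R T, h, filterMap_rotationExponent]
  · rw [← filterMap_reflectionExponent R T, h, filterMap_reflectionExponent]

theorem mul_mem_piSet {G : Type*} [Group G] {A B : Multiset G} {g h : G} (hg : g ∈ piSet A)
    (hh : h ∈ piSet B) : g * h ∈ piSet (A + B) := by
  obtain ⟨l, rfl, rfl⟩ := hg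
  obtain ⟨l', rfl, rfl⟩ := hh
  exact ⟨l ++ l', by simp, by simp⟩

theorem singleton_mem_piSet {G : Type*} [Group G] (g : G) : g ∈ piSet ({g} : Multiset G) :=
  ⟨[g], rfl, by simp⟩

theorem r_sum_mem_piSet (R : Multiset (ZMod m)) : r R.sum ∈ piSet (R.map r) := by
  induction R using Multiset.induction_on with
  | empty => exact ⟨[], rfl, by simp⟩
  | cons x R ih =>
    simpa [← Multiset.singleton_add] using mul_mem_piSet (singleton_mem_piSet (r x)) ih

theorem r_sub_mem_piSet {P N : Multiset (ZMod m)} (h : Multiset.card P = Multiset.card N) :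
    r (P.sum - N.sum) ∈ piSet ((P + N).map sr) := by
  induction P using Multiset.induction_on generalizing N with
  | empty =>
    obtain rfl : N = 0 := Multiset.card_eq_zero.1 (by simpa using h.symm)
    exact ⟨[], rfl, by simp⟩
  | cons a P ih =>
    obtain ⟨b, hb⟩ := Multiset.card_pos_iff_exists_mem.1
      (show 0 < Multiset.card N by rw [← h]; simp)
    obtain ⟨N, rfl⟩ := Multiset.exists_cons_of_mem hb
    have h' := mul_mem_piSet (mul_mem_piSet (singleton_mem_piSet (sr b)) (singleton_mem_piSet (sr a)))
      (ih (N := N) (by simpa using h))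
    convert h' using 1
    · simp only [Multiset.map_add, Multiset.map_cons]
      simp only [← Multiset.singleton_add]
      congr 1
      abel
    · simp only [sr_mul_sr, r_mul_r, Multiset.sum_cons]
      congr 1
      abel

theorem exists_signs_of_prod (l : List (DihedralGroup m)) :
    ∃ R₁ R₂ T₁ T₂ : Multiset (ZMod m), (l : Multiset _) = dihedralSeq (R₁ + R₂) (T₁ + T₂) ∧
      (T₁ + T₂ = 0 → R₂ = 0) ∧
      (l.prod = r (R₁.sum - R₂.sum + (T₁.sum - T₂.sum)) ∧ Multiset.card T₁ = Multiset.card T₂ ∨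
        l.prod = sr (R₁.sum - R₂.sum + (T₁.sum - T₂.sum)) ∧
          Multiset.card T₁ = Multiset.card T₂ + 1) := by
  induction l with
  | nil => exact ⟨0, 0, 0, 0, rfl, by simp, Or.inl (by simp)⟩
  | cons g l ih =>
    obtain ⟨R₁, R₂, T₁, T₂, hl, hR, h⟩ := ih
    cases g with
    | r i =>
      rcases h with ⟨h, hc⟩ | ⟨h, hc⟩
      · refine ⟨i ::ₘ R₁, R₂, T₁, T₂, ?_, hR, Or.inl ⟨?_, hc⟩⟩
        · rw [← Multiset.cons_coe, hl]
          simp [dihedralSeq]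
        · rw [List.prod_cons, h, r_mul_r, Multiset.sum_cons]
          congr 1
          abel
      · refine ⟨R₁, i ::ₘ R₂, T₁, T₂, ?_, ?_, Or.inr ⟨?_, hc⟩⟩
        · rw [← Multiset.cons_coe, hl]
          simp [dihedralSeq]
        · intro h0
          have := congrArg Multiset.card h0
          simp at this
          simp [this] at hc
        · rw [List.prod_cons, h, r_mul_sr, Multiset.sum_cons]
          congr 1
          abel
    | sr i =>
      rcases h with ⟨h, hc⟩ | ⟨h, hc⟩
      · refine ⟨R₁, R₂, i ::ₘ T₁, T₂, ?_, by simp, Or.inr ⟨?_, by simp [hc]⟩⟩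
        · rw [← Multiset.cons_coe, hl]
          simp [dihedralSeq]
        · rw [List.prod_cons, h, sr_mul_r, Multiset.sum_cons]
          congr 1
          abel
      · refine ⟨R₁, R₂, T₁, i ::ₘ T₂, ?_, by simp, Or.inl ⟨?_, by simp [hc]⟩⟩
        · rw [← Multiset.cons_coe, hl]
          simp [dihedralSeq]
        · rw [List.prod_cons, h, sr_mul_sr, Multiset.sum_cons]
          congr 1
          abel

theorem exists_signs_of_isProductOne {R T : Multiset (ZMod m)}
    (h : IsProductOne (dihedralSeq R T)) :
    ∃ R₁ R₂ T₁ T₂ : Multiset (ZMod m), R₁ + R₂ = R ∧ T₁ + T₂ = T ∧ (T = 0 → R₂ = 0) ∧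
      Multiset.card T₁ = Multiset.card T₂ ∧ R₁.sum - R₂.sum + (T₁.sum - T₂.sum) = 0 := by
  obtain ⟨l, hl, hprod⟩ := h
  obtain ⟨R₁, R₂, T₁, T₂, hl', hR, h⟩ := exists_signs_of_prod l
  rw [hl, dihedralSeq_inj] at hl'
  obtain ⟨rfl, rfl⟩ := hl'
  rw [hprod, DihedralGroup.one_def] at h
  rcases h with ⟨h, hc⟩ | ⟨h, -⟩
  · exact ⟨R₁, R₂, T₁, T₂, rfl, rfl, hR, hc, (r.inj h).symm⟩
  · exact absurd h nofun

theorem isProductOne_rotations {R : Multiset (ZMod m)} :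
    IsProductOne (dihedralSeq R 0) ↔ R.sum = 0 := by
  constructor
  · intro h
    obtain ⟨R₁, R₂, T₁, T₂, rfl, hT, hR, -, h0⟩ := exists_signs_of_isProductOne h
    rw [add_eq_zero] at hT
    simpa [hR rfl, hT.1, hT.2] using h0
  · intro h
    obtain ⟨l, hl, hp⟩ := r_sum_mem_piSet R
    exact ⟨l, by simp [hl, dihedralSeq], by rw [hp, h, DihedralGroup.one_def]⟩

theorem isProductOne_dihedralSeq {R T : Multiset (ZMod m)} (hT : T ≠ 0) :
    IsProductOne (dihedralSeq R T) ↔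
      ∃ x ∈ signedValues R, ∃ y ∈ balancedValues T, x + y = 0 := by
  constructor
  · intro h
    obtain ⟨R₁, R₂, T₁, T₂, rfl, rfl, -, hc, h0⟩ := exists_signs_of_isProductOne h
    exact ⟨_, ⟨R₁, R₂, rfl, rfl⟩, _, ⟨T₁, T₂, rfl, hc, rfl⟩, h0⟩
  · rintro ⟨_, ⟨R₁, R₂, rfl, rfl⟩, _, ⟨T₁, T₂, rfl, hc, rfl⟩, h0⟩
    have hpos : 0 < Multiset.card T₁ := by
      have := Multiset.card_pos.2 hT
      rw [Multiset.card_add] at this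
      omega
    obtain ⟨a, ha⟩ := Multiset.card_pos_iff_exists_mem.1 hpos
    obtain ⟨b, hb⟩ := Multiset.card_pos_iff_exists_mem.1 (hc ▸ hpos)
    obtain ⟨P, rfl⟩ := Multiset.exists_cons_of_mem ha
    obtain ⟨N, rfl⟩ := Multiset.exists_cons_of_mem hb
    have h := mul_mem_piSet (mul_mem_piSet (mul_mem_piSet (mul_mem_piSet
      (r_sub_mem_piSet (P := P) (N := N) (by simpa using hc)) (r_sum_mem_piSet R₁))
      (singleton_mem_piSet (sr b))) (r_sum_mem_piSet R₂)) (singleton_mem_piSet (sr a))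
    obtain ⟨l, hl, hp⟩ := h
    refine ⟨l, ?_, ?_⟩
    · rw [hl]
      simp only [dihedralSeq, Multiset.map_add, Multiset.map_cons]
      simp only [← Multiset.singleton_add]
      abel
    · rw [hp, DihedralGroup.one_def, ← h0]
      simp only [r_mul_r, r_mul_sr, sr_mul_r, sr_mul_sr, Multiset.sum_cons]
      congr 1
      abel

/-- A sequence of rotations and reflections is an atom if it admits no nontrivial splitting. -/
theorem isAtomSeq_dihedralSeq {R T : Multiset (ZMod m)} :
    IsAtomSeq (dihedralSeq R T) ↔ ¬(R = 0 ∧ T = 0) ∧ IsProductOne (dihedralSeq R T) ∧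
      ∀ R₁ R₂ T₁ T₂ : Multiset (ZMod m), R₁ + R₂ = R → T₁ + T₂ = T →
        IsProductOne (dihedralSeq R₁ T₁) → IsProductOne (dihedralSeq R₂ T₂) →
          (R₁ = 0 ∧ T₁ = 0) ∨ (R₂ = 0 ∧ T₂ = 0) := by
  refine and_congr (not_congr dihedralSeq_eq_zero) (and_congr Iff.rfl ⟨fun h => ?_, fun h => ?_⟩)
  · intro R₁ R₂ T₁ T₂ hR hT h₁ h₂
    simpa only [dihedralSeq_eq_zero] using
      h _ _ (by rw [← hR, ← hT, dihedralSeq_add]) h₁ h₂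
  · intro A B hAB hA hB
    obtain ⟨R₁, T₁, rfl⟩ := exists_eq_dihedralSeq A
    obtain ⟨R₂, T₂, rfl⟩ := exists_eq_dihedralSeq B
    rw [← dihedralSeq_add, dihedralSeq_inj] at hAB
    simpa only [dihedralSeq_eq_zero] using h _ _ _ _ hAB.1.symm hAB.2.symm hA hB

end Dihedral

section AdditiveCombinatorics

open scoped Pointwise

variable {α : Type*} [AddCommGroup α]

/-- The set of sums of subsequences of `R`. -/
def subsums (R : Multiset α) : Set α := {x | ∃ I ≤ R, I.sum = x}

theorem card_lt_ncard_subsums [Finite α] (R : Multiset α)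
    (hR : ∀ I ≤ R, I.sum = 0 → I = 0) : Multiset.card R < (subsums R).ncard := by
  induction R using Multiset.induction_on with
  | empty =>
    rw [Multiset.card_zero, Set.ncard_pos]
    exact ⟨0, 0, le_rfl, rfl⟩
  | cons g R ih =>
    have hlt : subsums R ⊂ subsums (g ::ₘ R) := by
      refine ⟨fun x ⟨I, hI, hx⟩ => ⟨I, hI.trans (Multiset.le_cons_self R g), hx⟩, fun hsub => ?_⟩
      have himage : (fun x => g + x) '' subsums R ⊆ subsums R := by
        rintro _ ⟨_, ⟨I, hI, rfl⟩, rfl⟩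
        exact hsub ⟨g ::ₘ I, Multiset.cons_le_cons g hI, by simp⟩
      have heq := Set.eq_of_subset_of_ncard_le himage
        (Set.ncard_image_of_injective _ (add_right_injective g)).ge
      have h0 : (0 : α) ∈ (fun x => g + x) '' subsums R := by
        rw [heq]
        exact ⟨0, Multiset.zero_le _, rfl⟩
      obtain ⟨_, ⟨I, hI, rfl⟩, h⟩ := h0
      have := hR (g ::ₘ I) (Multiset.cons_le_cons g hI) (by simpa using h)
      simp at this
    have h1 := Set.ncard_lt_ncard hlt
    have h2 := ih fun I hI => hR I (hI.trans (Multiset.le_cons_self R g))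
    rw [Multiset.card_cons]
    omega

theorem exists_zero_sum [Finite α] {R : Multiset α} (hR : Nat.card α ≤ Multiset.card R) :
    ∃ I ≤ R, I ≠ 0 ∧ I.sum = 0 := by
  by_contra! h
  have h1 := card_lt_ncard_subsums R fun I hI h0 => by_contra fun hne => h I hI hne h0
  have h2 := Set.ncard_le_card (subsums R)
  omega

theorem add_mem_of_mem_stabilizer {V : Set α} {h v : α} (hh : h ∈ AddAction.stabilizer α V)
    (hv : v ∈ V) : h + v ∈ V := by
  have h1 : h +ᵥ V = V := hh
  rw [← h1]
  exact Set.vadd_mem_vadd_set hv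

theorem mem_of_sub_mem_stabilizer {V : Set α} {v w : α}
    (hh : w - v ∈ AddAction.stabilizer α V) (hv : v ∈ V) : w ∈ V := by
  simpa using add_mem_of_mem_stabilizer hh hv

theorem two_mem_stabilizer_of_ncard_le [Finite α] {V W : Set α} {d : α}
    (hadd : ∀ v ∈ V, v + d ∈ W) (hsub : ∀ v ∈ V, v - d ∈ W) (hcard : W.ncard ≤ V.ncard) :
    d + d ∈ AddAction.stabilizer α V := by
  have h1 : d +ᵥ V = W := by
    refine Set.eq_of_subset_of_ncard_le ?_ (by simpa using hcard)
    rintro _ ⟨v, hv, rfl⟩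
    simpa [add_comm] using hadd v hv
  have h2 : -d +ᵥ V = W := by
    refine Set.eq_of_subset_of_ncard_le ?_ (by simpa using hcard)
    rintro _ ⟨v, hv, rfl⟩
    simpa [sub_eq_neg_add] using hsub v hv
  change (d + d) +ᵥ V = V
  rw [add_vadd, h1, ← h2, vadd_vadd]
  simp

theorem add_mem_signedValues_cons {R : Multiset α} {v : α} (hv : v ∈ signedValues R) (g : α) :
    v + g ∈ signedValues (g ::ₘ R) := by
  obtain ⟨P, N, rfl, rfl⟩ := hv
  exact ⟨g ::ₘ P, N, by simp, by rw [Multiset.sum_cons]; abel⟩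

theorem sub_mem_signedValues_cons {R : Multiset α} {v : α} (hv : v ∈ signedValues R) (g : α) :
    v - g ∈ signedValues (g ::ₘ R) := by
  obtain ⟨P, N, rfl, rfl⟩ := hv
  exact ⟨P, g ::ₘ N, by simp, by rw [Multiset.sum_cons]; abel⟩

theorem mem_signedValues_of_cons {R : Multiset α} {g v : α} (hv : v ∈ signedValues (g ::ₘ R)) :
    v - g ∈ signedValues R ∨ v + g ∈ signedValues R := by
  obtain ⟨P, N, h, rfl⟩ := hv
  have hg : g ∈ P + N := h ▸ Multiset.mem_cons_self g R
  rcases Multiset.mem_add.1 hg with hg | hg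
  · obtain ⟨P, rfl⟩ := Multiset.exists_cons_of_mem hg
    refine Or.inl ⟨P, N, by simpa using h, ?_⟩
    rw [Multiset.sum_cons]
    abel
  · obtain ⟨N, rfl⟩ := Multiset.exists_cons_of_mem hg
    refine Or.inr ⟨P, N, by simpa using h, ?_⟩
    rw [Multiset.sum_cons]
    abel

theorem add_mem_signedValues_add {N : Multiset α} {v : α} (hv : v ∈ signedValues N)
    (I : Multiset α) : v + I.sum ∈ signedValues (N + I) := by
  obtain ⟨P, M, rfl, rfl⟩ := hv
  exact ⟨P + I, M, by abel, by rw [Multiset.sum_add]; abel⟩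

theorem add_mem_balancedValues_add {K A B : Multiset α} {v : α} (hv : v ∈ balancedValues K)
    (hAB : Multiset.card A = Multiset.card B) :
    v + (A.sum - B.sum) ∈ balancedValues (K + (A + B)) := by
  obtain ⟨P, M, rfl, hc, rfl⟩ := hv
  exact ⟨P + A, M + B, by abel, by simp [hc, hAB], by simp only [Multiset.sum_add]; abel⟩

theorem exists_sub_mem_of_mem_signedValues_add {H : AddSubgroup α} {R N : Multiset α} {x : α}
    (hR : ∀ g ∈ R, g + g ∈ H) (hx : x ∈ signedValues (R + N)) :
    ∃ v ∈ signedValues N, x - v - R.sum ∈ H := by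
  induction R using Multiset.induction_on generalizing x with
  | empty => exact ⟨x, by simpa using hx, by simp⟩
  | cons g R ih =>
    rw [Multiset.cons_add] at hx
    have hR' : ∀ g ∈ R, g + g ∈ H := fun a ha => hR a (by simp [ha])
    rcases mem_signedValues_of_cons hx with h | h
    · obtain ⟨v, hv, hmem⟩ := ih hR' h
      refine ⟨v, hv, ?_⟩
      rw [Multiset.sum_cons]
      convert hmem using 1
      abel
    · obtain ⟨v, hv, hmem⟩ := ih hR' h
      refine ⟨v, hv, ?_⟩
      rw [Multiset.sum_cons]
      convert H.sub_mem hmem (hR g (by simp)) using 1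
      abel

theorem two_sum_sub_sum_mem {H : AddSubgroup α} {A B : Multiset α}
    (hc : Multiset.card A = Multiset.card B)
    (h : ∀ a ∈ A, ∀ b ∈ B, (a - b) + (a - b) ∈ H) :
    (A.sum - B.sum) + (A.sum - B.sum) ∈ H := by
  induction A using Multiset.induction_on generalizing B with
  | empty =>
    obtain rfl : B = 0 := Multiset.card_eq_zero.1 (by simpa using hc.symm)
    simp
  | cons a A ih =>
    obtain ⟨b, hb⟩ := Multiset.card_pos_iff_exists_mem.1
      (show 0 < Multiset.card B by rw [← hc]; simp)
    obtain ⟨B, rfl⟩ := Multiset.exists_cons_of_mem hb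
    have h1 := ih (B := B) (by simpa using hc) fun x hx y hy => h x (by simp [hx]) y (by simp [hy])
    convert H.add_mem (h a (by simp) b (by simp)) h1 using 1
    simp only [Multiset.sum_cons]
    abel

theorem exists_signedValues_saturated [Finite α] (R : Multiset α) :
    ∃ N R' : Multiset α, N + R' = R ∧ Multiset.card N < (signedValues N).ncard ∧
      ∀ g ∈ R', g + g ∈ AddAction.stabilizer α (signedValues N) := by
  suffices H : ∀ (R' N : Multiset α), N + R' = R →
      Multiset.card N < (signedValues N).ncard → ∃ N R' : Multiset α, N + R' = R ∧
        Multiset.card N < (signedValues N).ncard ∧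
        ∀ g ∈ R', g + g ∈ AddAction.stabilizer α (signedValues N) by
    refine H R 0 (by simp) ?_
    rw [Multiset.card_zero, Set.ncard_pos]
    exact ⟨0, 0, 0, by simp, by simp⟩
  intro R'
  induction hk : Multiset.card R' generalizing R' with
  | zero =>
    intro N hN hcard
    obtain rfl := Multiset.card_eq_zero.1 hk
    exact ⟨N, 0, hN, hcard, by simp⟩
  | succ k ih =>
    intro N hN hcard
    by_cases hst : ∀ g ∈ R', g + g ∈ AddAction.stabilizer α (signedValues N)
    · exact ⟨N, R', hN, hcard, hst⟩
    · push Not at hst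
      obtain ⟨g, hg, hst⟩ := hst
      obtain ⟨R', rfl⟩ := Multiset.exists_cons_of_mem hg
      refine ih R' (by simpa using hk) (g ::ₘ N) (by rw [← hN]; simp) ?_
      by_contra! hle
      rw [Multiset.card_cons] at hle
      exact hst (two_mem_stabilizer_of_ncard_le
        (fun v hv => add_mem_signedValues_cons hv g)
        (fun v hv => sub_mem_signedValues_cons hv g) (by omega))

theorem exists_balancedValues_saturated [Finite α] (V : Set α) {T₁ T₂ : Multiset α}
    (hT : Multiset.card T₁ = Multiset.card T₂) :
    ∃ K₁ K₂ Q₁ Q₂ : Multiset α, K₁ + Q₁ = T₁ ∧ K₂ + Q₂ = T₂ ∧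
      Multiset.card K₁ = Multiset.card K₂ ∧ Multiset.card Q₁ = Multiset.card Q₂ ∧
      V.ncard + Multiset.card K₁ ≤ (V + balancedValues (K₁ + K₂)).ncard ∧
      ∀ a ∈ Q₁, ∀ b ∈ Q₂,
        (a - b) + (a - b) ∈ AddAction.stabilizer α (V + balancedValues (K₁ + K₂)) := by
  suffices H : ∀ (Q₁ K₁ K₂ Q₂ : Multiset α), K₁ + Q₁ = T₁ → K₂ + Q₂ = T₂ →
      Multiset.card K₁ = Multiset.card K₂ → Multiset.card Q₁ = Multiset.card Q₂ →
      V.ncard + Multiset.card K₁ ≤ (V + balancedValues (K₁ + K₂)).ncard →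
      ∃ K₁ K₂ Q₁ Q₂ : Multiset α, K₁ + Q₁ = T₁ ∧ K₂ + Q₂ = T₂ ∧
      Multiset.card K₁ = Multiset.card K₂ ∧ Multiset.card Q₁ = Multiset.card Q₂ ∧
      V.ncard + Multiset.card K₁ ≤ (V + balancedValues (K₁ + K₂)).ncard ∧
      ∀ a ∈ Q₁, ∀ b ∈ Q₂,
        (a - b) + (a - b) ∈ AddAction.stabilizer α (V + balancedValues (K₁ + K₂)) by
    refine H T₁ 0 0 T₂ (by simp) (by simp) rfl hT ?_
    refine Set.ncard_le_ncard fun v hv => ?_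
    exact ⟨v, hv, 0, ⟨0, 0, by simp⟩, by simp⟩
  intro Q₁
  induction hk : Multiset.card Q₁ generalizing Q₁ with
  | zero =>
    intro K₁ K₂ Q₂ h₁ h₂ hK hQ hcard
    obtain rfl := Multiset.card_eq_zero.1 hk
    exact ⟨K₁, K₂, 0, Q₂, h₁, h₂, hK, by simpa using hQ, hcard, by simp⟩
  | succ k ih =>
    intro K₁ K₂ Q₂ h₁ h₂ hK hQ hcard
    by_cases hst : ∀ a ∈ Q₁, ∀ b ∈ Q₂,
        (a - b) + (a - b) ∈ AddAction.stabilizer α (V + balancedValues (K₁ + K₂))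
    · exact ⟨K₁, K₂, Q₁, Q₂, h₁, h₂, hK, by omega, hcard, hst⟩
    · push Not at hst
      obtain ⟨a, ha, b, hb, hst⟩ := hst
      obtain ⟨Q₁, rfl⟩ := Multiset.exists_cons_of_mem ha
      obtain ⟨Q₂, rfl⟩ := Multiset.exists_cons_of_mem hb
      refine ih Q₁ (by simpa using hk) (a ::ₘ K₁) (b ::ₘ K₂) Q₂ (by rw [← h₁]; simp)
        (by rw [← h₂]; simp) (by simp [hK]) (by simpa using hQ) ?_
      by_contra! hlt
      rw [Multiset.card_cons] at hlt
      have hadd : a ::ₘ K₁ + b ::ₘ K₂ = K₁ + K₂ + ({a} + {b}) := by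
        simp only [← Multiset.singleton_add]
        abel
      have hadd' : a ::ₘ K₁ + b ::ₘ K₂ = K₁ + K₂ + ({b} + {a}) := by
        rw [hadd, add_comm ({a} : Multiset α) {b}]
      refine hst (two_mem_stabilizer_of_ncard_le ?_ ?_
        (show (V + balancedValues (a ::ₘ K₁ + b ::ₘ K₂)).ncard ≤ _ by omega))
      · rintro _ ⟨v, hv, w, hw, rfl⟩
        refine ⟨v, hv, w + (a - b), ?_, by simp only []; abel⟩
        rw [hadd]
        simpa using add_mem_balancedValues_add hw (A := {a}) (B := {b}) rfl
      · rintro _ ⟨v, hv, w, hw, rfl⟩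
        refine ⟨v, hv, w + (b - a), ?_, by simp only []; abel⟩
        rw [hadd']
        simpa using add_mem_balancedValues_add hw (A := {b}) (B := {a}) rfl

theorem exists_add_card_eq {β : Type*} {C : Multiset β} (hC : Even (Multiset.card C)) :
    ∃ C₁ C₂ : Multiset β, C₁ + C₂ = C ∧ Multiset.card C₁ = Multiset.card C₂ := by
  obtain ⟨k, hk⟩ := hC
  obtain ⟨l, rfl⟩ := Quot.exists_rep C
  refine ⟨(l.take k : List β), (l.drop k : List β), ?_, ?_⟩
  · rw [Multiset.coe_add, List.take_append_drop]
    rfl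
  · have : l.length = k + k := hk
    simp [this]

end AdditiveCombinatorics

section Reduction

open DihedralGroup
open scoped Pointwise

variable {m : ℕ}

theorem two_mul_ncard_le_of_sub_even [NeZero m] (hm : 2 ∣ m) {V : Set (ZMod m)}
    (hV : ∀ v ∈ V, ∀ w ∈ V, ZMod.castHom hm (ZMod 2) v = ZMod.castHom hm (ZMod 2) w) :
    2 * V.ncard ≤ m := by
  have hdisj : Disjoint V ((1 : ZMod m) +ᵥ V) := by
    rw [Set.disjoint_left]
    rintro _ hv ⟨w, hw, rfl⟩
    have h := hV _ hv _ hw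
    simp only [vadd_eq_add, map_add, map_one] at h
    simp at h
  have h1 := Set.ncard_union_eq hdisj
  have h2 := Set.ncard_le_card (V ∪ ((1 : ZMod m) +ᵥ V))
  have h3 : ((1 : ZMod m) +ᵥ V).ncard = V.ncard := by simp
  rw [Nat.card_zmod] at h2
  omega

theorem castHom_eq_of_mem_signedValues (hm : 2 ∣ m) {R : Multiset (ZMod m)} {x : ZMod m}
    (hx : x ∈ signedValues R) :
    ZMod.castHom hm (ZMod 2) x = ZMod.castHom hm (ZMod 2) R.sum := by
  obtain ⟨P, N, rfl, rfl⟩ := hx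
  rw [map_sub, Multiset.sum_add, map_add, CharTwo.sub_eq_add]

theorem balancedValues_subset_signedValues {α : Type*} [AddCommGroup α] (T : Multiset α) :
    balancedValues T ⊆ signedValues T := by
  rintro x ⟨P, N, h, -, hx⟩
  exact ⟨P, N, h, hx⟩

theorem isProductOne_dihedralSeq_of_sum {I J₁ J₂ : Multiset (ZMod m)}
    (hJ : Multiset.card J₁ = Multiset.card J₂) (h : I.sum + (J₁.sum - J₂.sum) = 0) :
    IsProductOne (dihedralSeq I (J₁ + J₂)) := by
  by_cases h0 : J₁ + J₂ = 0
  · rw [h0, isProductOne_rotations]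
    obtain ⟨rfl, rfl⟩ := add_eq_zero.1 h0
    simpa using h
  · rw [isProductOne_dihedralSeq h0]
    exact ⟨I.sum, ⟨I, 0, by simp, by simp⟩, J₁.sum - J₂.sum, ⟨J₁, J₂, rfl, hJ, rfl⟩, h⟩

theorem isProductOne_dihedralSeq_of_neg_mem {N I K C₁ C₂ : Multiset (ZMod m)}
    (hC : Multiset.card C₁ = Multiset.card C₂) (h0 : K + (C₁ + C₂) ≠ 0)
    (h : -(I.sum + (C₁.sum - C₂.sum)) ∈ signedValues N + balancedValues K) :
    IsProductOne (dihedralSeq (N + I) (K + (C₁ + C₂))) := by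
  obtain ⟨v, hv, b, hb, hvb⟩ := h
  rw [isProductOne_dihedralSeq h0]
  refine ⟨_, add_mem_signedValues_add hv I, _, add_mem_balancedValues_add hb hC, ?_⟩
  simp only at hvb
  calc v + I.sum + (b + (C₁.sum - C₂.sum)) = (v + b) + (I.sum + (C₁.sum - C₂.sum)) := by abel
    _ = 0 := by rw [hvb]; abel

theorem IsAtomSeq.exists_reduction [NeZero m] (hm : 2 ∣ m) {R T : Multiset (ZMod m)}
    (hA : IsAtomSeq (dihedralSeq R T)) :
    ∃ N R' K Q : Multiset (ZMod m), N + R' = R ∧ K + Q = T ∧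
      Multiset.card N < (signedValues N).ncard ∧
      2 * (signedValues N).ncard + Multiset.card K ≤ m ∧
      Even (Multiset.card K) ∧ Even (Multiset.card Q) ∧
      (∀ g ∈ R', g + g ∈ AddAction.stabilizer (ZMod m) (signedValues N)) ∧
      ∀ I J₁ J₂ : Multiset (ZMod m), I ≤ R' → J₁ + J₂ ≤ Q →
        Multiset.card J₁ = Multiset.card J₂ → J₁ + J₂ ≠ T →
        I.sum + (J₁.sum - J₂.sum) = 0 → I = 0 ∧ J₁ = 0 := by
  obtain ⟨-, hPO, hatom⟩ := isAtomSeq_dihedralSeq.1 hA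
  obtain ⟨R₁, R₂, T₁, T₂, hR, hTT, -, hcT, hsum⟩ := exists_signs_of_isProductOne hPO
  obtain ⟨N, R', hN, hNcard, hst⟩ := exists_signedValues_saturated R
  obtain ⟨K₁, K₂, Q₁, Q₂, rfl, rfl, hK, hQ, hle, hst'⟩ :=
    exists_balancedValues_saturated (signedValues N) hcT
  set V := signedValues N + balancedValues (K₁ + K₂) with hVdef
  have hV : 2 * V.ncard ≤ m := by
    refine two_mul_ncard_le_of_sub_even hm ?_
    rintro _ ⟨v, hv, b, hb, rfl⟩ _ ⟨v', hv', b', hb', rfl⟩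
    simp only [map_add]
    rw [castHom_eq_of_mem_signedValues hm hv, castHom_eq_of_mem_signedValues hm hv',
      castHom_eq_of_mem_signedValues hm (balancedValues_subset_signedValues _ hb),
      castHom_eq_of_mem_signedValues hm (balancedValues_subset_signedValues _ hb')]
  have hall : ∀ a ∈ Q₁, ∀ b ∈ Q₁ + Q₂, (a - b) + (a - b) ∈ AddAction.stabilizer (ZMod m) V := by
    intro a ha b hb
    rcases Multiset.mem_add.1 hb with hb | hb
    · obtain ⟨c, hc⟩ := Multiset.card_pos_iff_exists_mem.1
        (hQ ▸ Multiset.card_pos_iff_exists_mem.2 ⟨a, ha⟩)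
      convert AddSubgroup.sub_mem _ (hst' a ha c hc) (hst' b hb c hc) using 1
      abel
    · exact hst' a ha b hb
  have hbase : -(R'.sum + (Q₁.sum - Q₂.sum)) ∈ V := by
    have hx : R₁.sum - R₂.sum ∈ signedValues (R' + N) := ⟨R₁, R₂, by rw [hR, ← hN, add_comm], rfl⟩
    obtain ⟨v, hv, hmem⟩ := exists_sub_mem_of_mem_signedValues_add hst hx
    have hv' : R₁.sum - R₂.sum - R'.sum ∈ signedValues N :=
      mem_of_sub_mem_stabilizer (by convert hmem using 1; abel) hv
    refine ⟨_, hv', K₁.sum - K₂.sum, ⟨K₁, K₂, rfl, hK, rfl⟩, ?_⟩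
    simp only [Multiset.sum_add] at hsum
    simp only
    linear_combination hsum
  refine ⟨N, R', K₁ + K₂, Q₁ + Q₂, hN, by rw [← hTT]; abel, hNcard, ?_, ⟨_, by
    rw [Multiset.card_add, hK]⟩, ⟨_, by rw [Multiset.card_add, hQ]⟩, hst, ?_⟩
  · rw [Multiset.card_add]
    omega
  intro I J₁ J₂ hI hJQ hJ hJT h0
  obtain ⟨I', rfl⟩ := Multiset.le_iff_exists_add.1 hI
  obtain ⟨C, hC⟩ := Multiset.le_iff_exists_add.1 hJQ
  obtain ⟨C₁, C₂, rfl, hCC⟩ : ∃ C₁ C₂ : Multiset (ZMod m), C₁ + C₂ = C ∧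
      Multiset.card C₁ = Multiset.card C₂ := by
    apply exists_add_card_eq
    have := congrArg Multiset.card hC
    simp only [Multiset.card_add] at this
    exact ⟨Multiset.card Q₁ - Multiset.card J₁, by omega⟩
  have hTsplit : J₁ + J₂ + (K₁ + K₂ + (C₁ + C₂)) = T := by
    calc J₁ + J₂ + (K₁ + K₂ + (C₁ + C₂)) = K₁ + K₂ + (J₁ + J₂ + (C₁ + C₂)) := by abel
      _ = T := by rw [← hC, ← hTT]; abel
  have hne : K₁ + K₂ + (C₁ + C₂) ≠ 0 := by
    intro h
    rw [h, add_zero] at hTsplit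
    exact hJT hTsplit
  have hcompl : -(I'.sum + (C₁.sum - C₂.sum)) ∈ V := by
    refine mem_of_sub_mem_stabilizer ?_ hbase
    have hsumQ := congrArg Multiset.sum hC
    have hcardQ := congrArg Multiset.card hC
    simp only [Multiset.sum_add] at hsumQ
    simp only [Multiset.card_add] at hcardQ
    convert two_sum_sub_sum_mem (A := Q₁) (B := J₁ + C₁) (by rw [Multiset.card_add]; omega)
      (fun a ha b hb => hall a ha b ?_) using 1
    · simp only [Multiset.sum_add]
      linear_combination h0 - hsumQ
    · rw [hC]
      rcases Multiset.mem_add.1 hb with hb | hb <;> simp [hb]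
  rcases hatom I (N + I') (J₁ + J₂) _ (by rw [← hN]; abel) hTsplit
    (isProductOne_dihedralSeq_of_sum hJ h0)
    (isProductOne_dihedralSeq_of_neg_mem hCC hne hcompl) with h | h
  · exact ⟨h.1, (add_eq_zero.1 h.2).1⟩
  · exact absurd h.2 hne

end Reduction

section Davenport

open scoped Pointwise

variable {m : ℕ}

theorem card_filter_nsmul_eq_le [NeZero m] (k : ℕ) (hk : 0 < k) (X : Finset (ZMod m))
    (c : ZMod m) : (X.filter fun x => k • x = c).card ≤ k := by
  rcases (X.filter fun x => k • x = c).eq_empty_or_nonempty with h | ⟨x₀, hx₀⟩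
  · rw [h]
    simp
  · refine le_trans ?_ (IsAddCyclic.card_nsmul_eq_zero_le (α := ZMod m) hk)
    refine Finset.card_le_card_of_injOn (fun x => x - x₀) (fun x hx => ?_)
      (fun x _ y _ h => sub_left_injective h)
    rw [Finset.mem_filter] at hx₀
    have hx' := (Finset.mem_filter.1 hx).2
    refine Finset.mem_filter.2 ⟨Finset.mem_univ _, ?_⟩
    change k • (x - x₀) = 0
    rw [nsmul_sub, hx', hx₀.2, sub_self]

theorem ncard_subsums_le [NeZero m] {R N : Multiset (ZMod m)}
    (hN : (signedValues N).Nonempty)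
    (hR : ∀ g ∈ R, g + g ∈ AddAction.stabilizer (ZMod m) (signedValues N)) :
    (subsums R).ncard ≤ 2 * (signedValues N).ncard := by
  classical
  obtain ⟨v, hv⟩ := hN
  set X := (subsums R).toFinite.toFinset
  rw [Set.ncard_eq_toFinset_card (subsums R) (subsums R).toFinite]
  have h1 := Finset.card_le_mul_card_image (f := fun x : ZMod m => 2 • x) X 2
    (fun c _ => card_filter_nsmul_eq_le 2 two_pos X c)
  refine h1.trans (Nat.mul_le_mul_left 2 ?_)
  rw [Set.ncard_eq_toFinset_card (signedValues N) (signedValues N).toFinite]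
  refine Finset.card_le_card_of_injOn (fun x => x + v) (fun x hx => ?_)
    (fun x _ y _ h => add_left_injective v h)
  obtain ⟨y, hy, rfl⟩ := Finset.mem_image.1 hx
  obtain ⟨I, hI, rfl⟩ := (Set.Finite.mem_toFinset _).1 hy
  rw [Finset.mem_coe, Set.Finite.mem_toFinset]
  refine add_mem_of_mem_stabilizer ?_ hv
  have h2 : 2 • I.sum = (I.map fun g => g + g).sum := by
    rw [Multiset.sum_map_add, Multiset.map_id', two_nsmul]
  simp only [h2]
  refine AddSubgroup.multiset_sum_mem _ _ fun x hx => ?_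
  obtain ⟨g, hg, rfl⟩ := Multiset.mem_map.1 hx
  exact hR g (Multiset.mem_of_le hI hg)

theorem exists_many_differences [NeZero m] {Q : Finset (ZMod m)} (hQ : 4 ≤ Q.card)
    (hsidon : ∀ a ∈ Q, ∀ b ∈ Q, ∀ c ∈ Q, ∀ d ∈ Q, [a, b, c, d].Nodup → a + b ≠ c + d) :
    ∃ E : Finset (ZMod m), 2 * Q.card ≤ E.card + 3 ∧
      ∀ e ∈ E, ∃ a ∈ Q, ∃ b ∈ Q, a ≠ b ∧ e = a - b := by
  obtain ⟨a, ha⟩ : Q.Nonempty := Finset.card_pos.1 (by omega)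
  obtain ⟨b, hb, hab⟩ : ∃ b ∈ Q, 3 • b ≠ 3 • a := by
    by_contra! h
    have h1 := card_filter_nsmul_eq_le 3 (by norm_num) Q (3 • a)
    rw [Finset.filter_true_of_mem h] at h1
    omega
  have hne : a ≠ b := by
    rintro rfl
    exact hab rfl
  set A := (Q.erase a).image (fun x => x - a) with hA
  set B := (Q.erase b).image (fun x => x - b) with hB
  have hAc : A.card = Q.card - 1 := by
    rw [hA, Finset.card_image_of_injective _ sub_left_injective, Finset.card_erase_of_mem ha]
  have hBc : B.card = Q.card - 1 := by
    rw [hB, Finset.card_image_of_injective _ sub_left_injective, Finset.card_erase_of_mem hb]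
  have hmem : ∀ e ∈ A ∩ B, (e = b - a ∧ e + b ∈ Q) ∨ (e = a - b ∧ e + a ∈ Q) := by
    intro e he
    obtain ⟨heA, heB⟩ := Finset.mem_inter.1 he
    obtain ⟨x, hx, rfl⟩ := Finset.mem_image.1 heA
    obtain ⟨y, hy, hxy⟩ := Finset.mem_image.1 heB
    rw [Finset.mem_erase] at hx hy
    by_cases hxb : x = b
    · refine Or.inl ⟨by rw [hxb], ?_⟩
      rw [← hxy]
      simpa using hy.2
    · by_cases hya : y = a
      · exact Or.inr ⟨by rw [← hxy, hya], by simpa using hx.2⟩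
      · refine absurd ?_ (hsidon x hx.2 b hb y hy.2 a ha ?_)
        · linear_combination -hxy
        · have hxy' : x ≠ y := by
            rintro rfl
            exact hne (sub_right_injective hxy).symm
          simp only [List.nodup_cons, List.mem_cons, List.not_mem_nil, or_false, not_or,
            not_false_eq_true, List.nodup_nil, and_true]
          exact ⟨⟨hxb, hxy', hx.1⟩, ⟨Ne.symm hy.1, hne.symm⟩, hya⟩
  have hcontra : b - a ≠ a - b → b - a + b ∈ Q → a - b + a ∈ Q → False := by
    intro h hy hx
    refine hsidon _ hy _ hx a ha b hb ?_ (by ring)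
    simp only [List.nodup_cons, List.mem_cons, List.not_mem_nil, or_false, not_or,
      not_false_eq_true, List.nodup_nil, and_true]
    refine ⟨⟨fun h' => hab ?_, fun h' => h ?_, fun h' => hne ?_⟩, ⟨fun h' => hne ?_,
      fun h' => h ?_⟩, hne⟩
    · simp only [nsmul_eq_mul]
      push_cast
      linear_combination h'
    · linear_combination h'
    · linear_combination -h'
    · linear_combination h'
    · linear_combination -h'
  have hinter : (A ∩ B).card ≤ 1 := by
    rw [Finset.card_le_one]
    intro e he e' he'
    rcases hmem e he with ⟨h, hQ⟩ | ⟨h, hQ⟩ <;> rcases hmem e' he' with ⟨h', hQ'⟩ | ⟨h', hQ'⟩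
    · rw [h, h']
    · by_contra hee
      exact hcontra (by rwa [← h, ← h']) (h ▸ hQ) (h' ▸ hQ')
    · by_contra hee
      exact hcontra (by rw [← h, ← h']; exact Ne.symm hee) (h' ▸ hQ') (h ▸ hQ)
    · rw [h, h']
  refine ⟨A ∪ B, ?_, fun e he => ?_⟩
  · have := Finset.card_union_add_card_inter A B
    omega
  · rcases Finset.mem_union.1 he with he | he
    · obtain ⟨x, hx, rfl⟩ := Finset.mem_image.1 he
      rw [Finset.mem_erase] at hx
      exact ⟨x, hx.2, a, ha, hx.1, rfl⟩
    · obtain ⟨x, hx, rfl⟩ := Finset.mem_image.1 he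
      rw [Finset.mem_erase] at hx
      exact ⟨x, hx.2, b, hb, hx.1, rfl⟩

theorem ncard_subsums_add_le [NeZero m] {R : Multiset (ZMod m)} {E : Finset (ZMod m)}
    (h : ∀ e ∈ E, e ∉ subsums R) : (subsums R).ncard + E.card ≤ m := by
  have hdisj : Disjoint (subsums R) (E : Set (ZMod m)) :=
    Set.disjoint_left.2 fun x hx hxE => h x hxE hx
  rw [← Set.ncard_coe_finset, ← Set.ncard_union_eq hdisj]
  simpa using Set.ncard_le_card (subsums R ∪ (E : Set (ZMod m)))

theorem IsAtomSeq.card_le_of_rotations [NeZero m] {R : Multiset (ZMod m)}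
    (hA : IsAtomSeq (dihedralSeq R 0)) : Multiset.card R ≤ m := by
  obtain ⟨hne, hPO, hatom⟩ := isAtomSeq_dihedralSeq.1 hA
  have hR0 : R ≠ 0 := by simpa using hne
  rw [isProductOne_rotations] at hPO
  obtain ⟨g, hg⟩ := Multiset.exists_mem_of_ne_zero hR0
  obtain ⟨R, rfl⟩ := Multiset.exists_cons_of_mem hg
  by_contra! hlt
  rw [Multiset.card_cons] at hlt
  obtain ⟨I, hI, hI0, hIsum⟩ := exists_zero_sum (R := R) (by rw [Nat.card_zmod]; omega)
  obtain ⟨I', rfl⟩ := Multiset.le_iff_exists_add.1 hI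
  have h := hatom I (g ::ₘ I') 0 0 (by simp) (by simp) (isProductOne_rotations.2 hIsum)
    (isProductOne_rotations.2 (by simpa [hIsum] using hPO))
  simp [hI0] at h

/-- The large Davenport constant of `D_{2m}` for even `m` is at most `3 m / 2`, and atoms attaining
this bound have exactly two reflections. -/
theorem IsAtomSeq.two_mul_card_le [NeZero m] (hm : 2 ∣ m) {R T : Multiset (ZMod m)}
    (hA : IsAtomSeq (dihedralSeq R T)) :
    2 * (Multiset.card R + Multiset.card T) ≤ 3 * m ∧
      (2 * (Multiset.card R + Multiset.card T) = 3 * m → Multiset.card T = 2) := by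
  have hm0 := NeZero.pos m
  by_cases hT : T = 0
  · subst hT
    have := hA.card_le_of_rotations
    rw [Multiset.card_zero]
    omega
  obtain ⟨N, R', K, Q, rfl, rfl, hN, hs, ⟨k, hk⟩, ⟨q, hq⟩, hst, hF⟩ := hA.exists_reduction hm
  have hpos : 0 < Multiset.card (K + Q) := Multiset.card_pos.2 hT
  have hX : Multiset.card R' < (subsums R').ncard := by
    refine card_lt_ncard_subsums R' fun I hI h0 => ?_
    exact (hF I 0 0 hI (by simp) rfl (by simpa using Ne.symm hT) (by simpa using h0)).1
  have hX2 := ncard_subsums_le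
    (Set.nonempty_of_ncard_ne_zero (show (signedValues N).ncard ≠ 0 by omega)) hst
  simp only [Multiset.card_add] at hpos ⊢
  by_cases hq4 : Multiset.card Q < 4
  · omega
  have hpair : ∀ a b, {a, b} ≤ Q → b - a ∉ subsums R' := by
    rintro a b hab ⟨I, hI, hsum⟩
    have h := hF I {a} {b} hI hab rfl (fun h => ?_) (by simp [hsum])
    · simpa using h.2
    · have := congrArg Multiset.card h
      simp only [Multiset.card_add, Multiset.card_singleton] at this
      omega
  have hnodup : Q.Nodup := by
    rw [Multiset.nodup_iff_le]
    intro a ha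
    exact hpair a a ha ⟨0, Multiset.zero_le _, by simp⟩
  lift Q to Finset (ZMod m) using hnodup
  have hdiff : ∀ a ∈ Q, ∀ b ∈ Q, a ≠ b → a - b ∉ subsums R' := by
    intro a ha b hb hab
    refine hpair b a ((Multiset.le_iff_subset (by simpa using hab.symm)).2 ?_)
    intro x hx
    rcases Multiset.mem_cons.1 hx with rfl | hx
    · exact hb
    · rw [Multiset.mem_singleton] at hx
      exact hx ▸ ha
  have hQc : Multiset.card Q.val = Q.card := rfl
  by_cases hK : k = 0
  · obtain ⟨a, ha⟩ : Q.Nonempty := Finset.card_pos.1 (by omega)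
    have h := ncard_subsums_add_le (R := R') (E := (Q.erase a).image (fun x => x - a))
      (fun e he => by
        obtain ⟨x, hx, rfl⟩ := Finset.mem_image.1 he
        rw [Finset.mem_erase] at hx
        exact hdiff x hx.2 a ha hx.1)
    rw [Finset.card_image_of_injective _ sub_left_injective, Finset.card_erase_of_mem ha] at h
    omega
  · obtain ⟨E, hE, hE'⟩ := exists_many_differences (Q := Q) (by omega) (by
      intro a ha b hb c hc d hd hnd hsum
      have h := hF 0 {a, b} {c, d} (Multiset.zero_le _) ?_ rfl (fun h => ?_) (by simp [hsum])
      · simpa using h.2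
      · refine (Multiset.le_iff_subset (s := (([a, b, c, d] : List (ZMod m)) :
          Multiset (ZMod m))) hnd).2 ?_
        intro x hx
        simp only [Multiset.mem_coe, List.mem_cons, List.not_mem_nil, or_false] at hx
        rcases hx with rfl | rfl | rfl | rfl <;> assumption
      · have := congrArg Multiset.card h
        simp only [Multiset.card_add, Multiset.card_pair] at this
        omega)
    have h := ncard_subsums_add_le (R := R') (E := E) (fun e he => by
      obtain ⟨a, ha, b, hb, hab, rfl⟩ := hE' e he
      exact hdiff a ha b hb hab)
    omega

end Davenport

section Constructions

open DihedralGroup Multiset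

theorem exists_eq_replicate_add_replicate {α : Type*} {u v : α} {S : Multiset α}
    (hS : ∀ x ∈ S, x = u ∨ x = v) : ∃ a b : ℕ, S = replicate a u + replicate b v := by
  induction S using Multiset.induction_on with
  | empty => exact ⟨0, 0, by simp⟩
  | cons x S ih =>
    obtain ⟨a, b, rfl⟩ := ih fun y hy => hS y (mem_cons_of_mem hy)
    rcases hS x (mem_cons_self x _) with rfl | rfl
    · exact ⟨a + 1, b, by simp [replicate_succ]⟩
    · exact ⟨a, b + 1, by simp [replicate_succ]⟩

theorem replicate_add_replicate_inj {α : Type*} {u v : α} (huv : u ≠ v) {a b a' b' : ℕ}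
    (h : replicate a u + replicate b v = replicate a' u + replicate b' v) : a = a' ∧ b = b' := by
  classical
  have h1 := congrArg (count u) h
  have h2 := congrArg (count v) h
  simp only [count_add, count_replicate, huv, huv.symm, if_true, if_false] at h1 h2
  omega

theorem exists_replicate_of_add_eq_replicate {α : Type*} {a : α} {k : ℕ} {A B : Multiset α}
    (h : A + B = replicate k a) : ∃ p q : ℕ, p + q = k ∧ A = replicate p a ∧ B = replicate q a := by
  refine ⟨card A, card B, by rw [← card_add, h, card_replicate], eq_replicate_card.2 fun b hb => ?_,
    eq_replicate_card.2 fun b hb => ?_⟩ <;>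
  exact eq_of_mem_replicate (h ▸ mem_add.2 (by simp [hb]))

theorem one_ne_sr {n : ℕ} (i : ZMod n) : (1 : DihedralGroup n) ≠ sr i := by
  rw [one_def]
  exact nofun

section Odd

variable {n : ℕ}

/-- The sequence consisting of `a` copies of `τ` and `b` copies of `τ α`. -/
def reflectionSeq (n a b : ℕ) : Multiset (DihedralGroup n) :=
  replicate a (sr 0) + replicate b (sr 1)

theorem reflectionSeq_eq_dihedralSeq (a b : ℕ) :
    reflectionSeq n a b = dihedralSeq 0 (replicate a 0 + replicate b 1) := by
  simp [reflectionSeq, dihedralSeq]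

theorem card_reflectionSeq (a b : ℕ) : card (reflectionSeq n a b) = a + b := by
  simp [reflectionSeq]

theorem reflectionSeq_add (a b a' b' : ℕ) :
    reflectionSeq n a b + reflectionSeq n a' b' = reflectionSeq n (a + a') (b + b') := by
  simp only [reflectionSeq, replicate_add]
  abel

theorem reflectionSeq_eq_zero {a b : ℕ} : reflectionSeq n a b = 0 ↔ a = 0 ∧ b = 0 := by
  rw [← card_eq_zero, card_reflectionSeq]
  omega

theorem reflectionSeq_inj (hn : 3 ≤ n) {a b a' b' : ℕ}
    (h : reflectionSeq n a b = reflectionSeq n a' b') : a = a' ∧ b = b' := by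
  have : Fact (1 < n) := ⟨by omega⟩
  exact replicate_add_replicate_inj (by simp) h

theorem exists_eq_reflectionSeq {a b : ℕ} {S : Multiset (DihedralGroup n)}
    (hS : S ≤ reflectionSeq n a b) : ∃ c d : ℕ, S = reflectionSeq n c d := by
  refine exists_eq_replicate_add_replicate fun x hx => ?_
  have := mem_of_le hS hx
  simp only [reflectionSeq, mem_add, mem_replicate] at this
  tauto

theorem isProductOne_reflectionSeq_of_even {a b : ℕ} (ha : Even a) (hb : Even b) :
    IsProductOne (reflectionSeq n a b) := by
  obtain ⟨a, rfl⟩ := ha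
  obtain ⟨b, rfl⟩ := hb
  convert isProductOne_dihedralSeq_of_sum (m := n) (I := 0)
    (J₁ := replicate a 0 + replicate b 1) (J₂ := replicate a 0 + replicate b 1) rfl (by simp) using 1
  rw [← reflectionSeq_add, reflectionSeq_eq_dihedralSeq, ← dihedralSeq_add, add_zero]

theorem isProductOne_reflectionSeq_self : IsProductOne (reflectionSeq n n n) := by
  rw [reflectionSeq_eq_dihedralSeq]
  exact isProductOne_dihedralSeq_of_sum (by simp) (by simp)

theorem IsProductOne.reflectionSeq (hn : 3 ≤ n) {a b : ℕ}
    (h : IsProductOne (reflectionSeq n a b)) :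
    Even (a + b) ∧ (Odd b → n ≤ a ∧ n ≤ b) := by
  have : Fact (1 < n) := ⟨by omega⟩
  rw [reflectionSeq_eq_dihedralSeq] at h
  obtain ⟨R₁, R₂, T₁, T₂, hR, hT, -, hcard, hsum⟩ := exists_signs_of_isProductOne h
  obtain ⟨rfl, rfl⟩ := add_eq_zero.1 hR
  have hmem : ∀ x ∈ T₁ + T₂, x = (0 : ZMod n) ∨ x = 1 := by
    intro x hx
    rw [hT] at hx
    simp only [mem_add, mem_replicate] at hx
    tauto
  obtain ⟨a₁, b₁, rfl⟩ := exists_eq_replicate_add_replicate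
    fun x hx => hmem x (mem_add.2 (Or.inl hx))
  obtain ⟨a₂, b₂, rfl⟩ := exists_eq_replicate_add_replicate
    fun x hx => hmem x (mem_add.2 (Or.inr hx))
  obtain ⟨ha, hb⟩ : a₁ + a₂ = a ∧ b₁ + b₂ = b := by
    refine replicate_add_replicate_inj (zero_ne_one' (ZMod n)) ?_
    rw [← hT, replicate_add, replicate_add]
    abel
  simp only [card_add, card_replicate] at hcard
  refine ⟨⟨a₁ + b₁, by omega⟩, fun hodd => ?_⟩
  have hdvd : (n : ℤ) ∣ (b₁ : ℤ) - b₂ := by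
    rw [← ZMod.intCast_zmod_eq_zero_iff_dvd]
    simpa using hsum
  have hne : (b₁ : ℤ) - b₂ ≠ 0 := by
    rintro h0
    obtain ⟨c, hc⟩ := hodd
    omega
  have hle := Int.le_of_dvd (abs_pos.2 hne) ((dvd_abs _ _).2 hdvd)
  rcases abs_cases ((b₁ : ℤ) - b₂) with ⟨h1, -⟩ | ⟨h1, -⟩ <;> omega

theorem isAtomSeq_reflectionSeq_self (hn : 3 ≤ n) (hodd : Odd n) :
    IsAtomSeq (reflectionSeq n n n) := by
  refine ⟨fun h => ?_, isProductOne_reflectionSeq_self, fun A B hAB hA hB => ?_⟩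
  · have := (reflectionSeq_eq_zero.1 h).1
    omega
  · obtain ⟨a, b, rfl⟩ := exists_eq_reflectionSeq (hAB ▸ le_add_right A B)
    obtain ⟨a', b', rfl⟩ := exists_eq_reflectionSeq (hAB ▸ le_add_left B _)
    rw [reflectionSeq_add] at hAB
    obtain ⟨h1, h2⟩ := reflectionSeq_inj hn hAB
    rw [reflectionSeq_eq_zero, reflectionSeq_eq_zero]
    rcases Nat.even_or_odd b with hb | hb
    · have hb' : Odd b' := by
        rw [h2] at hodd
        exact (Nat.odd_add.1 (add_comm b b' ▸ hodd)).2 hb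
      have := hB.reflectionSeq hn |>.2 hb'
      omega
    · have := hA.reflectionSeq hn |>.2 hb
      omega

theorem IsAtomSeq.reflectionSeq_cases (hn : 3 ≤ n) (hodd : Odd n) {a b : ℕ}
    (h : IsAtomSeq (reflectionSeq n a b)) :
    (a = 2 ∧ b = 0) ∨ (a = 0 ∧ b = 2) ∨ (a = n ∧ b = n) := by
  obtain ⟨hne, hPO, hatom⟩ := h
  rw [Ne, reflectionSeq_eq_zero] at hne
  have key : ∀ c d a' b', a = c + a' → b = d + b' → IsProductOne (reflectionSeq n c d) →
      IsProductOne (reflectionSeq n a' b') → (c = 0 ∧ d = 0) ∨ (a' = 0 ∧ b' = 0) := by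
    intro c d a' b' ha hb h1 h2
    rw [← reflectionSeq_eq_zero (n := n), ← reflectionSeq_eq_zero (n := n)]
    exact hatom _ _ (by rw [reflectionSeq_add, ha, hb]) h1 h2
  obtain ⟨hev, hle⟩ := hPO.reflectionSeq hn
  rcases Nat.even_or_odd b with hb | hb
  · have ha : Even a := (Nat.even_add.1 hev).2 hb
    have hp := ha.two_dvd
    have hq := hb.two_dvd
    by_cases h2 : 2 ≤ a
    · have := key 2 0 (a - 2) b (by omega) (by omega)
        (isProductOne_reflectionSeq_of_even even_two Even.zero)
        (isProductOne_reflectionSeq_of_even ((Nat.even_sub h2).2 (by simp [ha])) hb)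
      omega
    · have h2 : 2 ≤ b := by omega
      have := key 0 2 a (b - 2) (by omega) (by omega)
        (isProductOne_reflectionSeq_of_even Even.zero even_two)
        (isProductOne_reflectionSeq_of_even ha ((Nat.even_sub h2).2 (by simp [hb])))
      omega
  · obtain ⟨ha', hb'⟩ := hle hb
    have ha : Odd a := Nat.not_even_iff_odd.1 fun ha =>
      Nat.not_even_iff_odd.2 hb ((Nat.even_add.1 hev).1 ha)
    have := key n n (a - n) (b - n) (by omega) (by omega) isProductOne_reflectionSeq_self
      (isProductOne_reflectionSeq_of_even (Nat.Odd.sub_odd ha hodd) (Nat.Odd.sub_odd hb hodd))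
    omega

theorem exists_sum_eq_reflectionSeq (hn : 3 ≤ n) (hodd : Odd n)
    {f : Multiset (Multiset (DihedralGroup n))} (hf : ∀ W ∈ f, IsAtomSeq W)
    (hf' : ∀ W ∈ f, ∃ a b, W = reflectionSeq n a b) :
    ∃ x y z : ℕ, card f = x + y + z ∧ f.sum = reflectionSeq n (2 * x + n * z) (2 * y + n * z) := by
  induction f using Multiset.induction_on with
  | empty => exact ⟨0, 0, 0, by simp, by simp [reflectionSeq]⟩
  | cons W f ih =>
    obtain ⟨x, y, z, hcard, hsum⟩ := ih (fun W hW => hf W (mem_cons_of_mem hW))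
      fun W hW => hf' W (mem_cons_of_mem hW)
    obtain ⟨a, b, rfl⟩ := hf' W (mem_cons_self W f)
    rw [sum_cons, hsum, reflectionSeq_add, card_cons, hcard]
    rcases (hf _ (mem_cons_self _ f)).reflectionSeq_cases hn hodd with
      ⟨rfl, rfl⟩ | ⟨rfl, rfl⟩ | ⟨rfl, rfl⟩
    · exact ⟨x + 1, y, z, by ring, by congr 1 <;> ring⟩
    · exact ⟨x, y + 1, z, by ring, by congr 1 <;> ring⟩
    · exact ⟨x, y, z + 1, by ring, by congr 1 <;> ring⟩

theorem pair_mem_LSystem_of_odd (hn : 3 ≤ n) (hodd : Odd n) :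
    ({2, 2 * n} : Set ℕ) ∈ LSystem (DihedralGroup n) := by
  have hatom := isAtomSeq_reflectionSeq_self hn hodd
  have hinv : (reflectionSeq n n n).map (·⁻¹) = reflectionSeq n n n := by
    simp [reflectionSeq]
  have h2 := two_mem_lengths_add hatom hatom
  have h2n := card_mem_lengths_add_inv (U := reflectionSeq n n n) (by
    simp [reflectionSeq, mem_replicate, one_ne_sr])
  rw [hinv, card_reflectionSeq, ← two_mul] at h2n
  refine ⟨_, isProductOne_of_mem_lengths h2, ?_⟩
  refine Set.Subset.antisymm (by rintro k (rfl | rfl) <;> assumption) fun k hk => ?_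
  obtain ⟨f, rfl, hf, hsum⟩ := mem_lengths_iff.1 hk
  rw [reflectionSeq_add] at hsum
  obtain ⟨x, y, z, hcard, hsum'⟩ := exists_sum_eq_reflectionSeq hn hodd hf fun W hW =>
    exists_eq_reflectionSeq (hsum ▸ single_le_sum (fun _ _ => zero_le _) W hW)
  obtain ⟨hx, hy⟩ := reflectionSeq_inj hn (hsum.symm.trans hsum')
  have hz : z < 3 := by
    by_contra! hz
    have := Nat.mul_le_mul_left n hz
    omega
  obtain ⟨c, hc⟩ := hodd
  rw [Set.mem_insert_iff, Set.mem_singleton_iff, hcard]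
  interval_cases z <;> omega

end Odd

section Even

variable {h : ℕ}

theorem exists_eq_sub_of_mem_signedValues_replicate {k : ℕ} {x : ZMod (2 * h)}
    (hx : x ∈ signedValues (replicate k (1 : ZMod (2 * h)))) :
    ∃ p q : ℕ, p + q = k ∧ x = p - q := by
  obtain ⟨P, N, hPN, rfl⟩ := hx
  obtain ⟨p, q, hpq, rfl, rfl⟩ := exists_replicate_of_add_eq_replicate hPN
  exact ⟨p, q, hpq, by simp⟩

theorem natCast_half_add_self : (h : ZMod (2 * h)) + h = 0 := by
  have : ((2 * h : ℕ) : ZMod (2 * h)) = 0 := ZMod.natCast_self _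
  push_cast at this
  linear_combination this

theorem eq_half_of_mem_balancedValues {y : ZMod (2 * h)}
    (hy : y ∈ balancedValues ({0, (h : ZMod (2 * h))} : Multiset (ZMod (2 * h)))) :
    y = h := by
  obtain ⟨P, N, hPN, hcard, rfl⟩ := hy
  have hc := congrArg card hPN
  rw [card_add, card_pair] at hc
  obtain ⟨a, rfl⟩ := card_eq_one.1 (show card P = 1 by omega)
  obtain ⟨b, rfl⟩ := card_eq_one.1 (show card N = 1 by omega)
  have hs := congrArg Multiset.sum hPN
  have ha : a ∈ ({0, (h : ZMod (2 * h))} : Multiset (ZMod (2 * h))) := hPN ▸ by simp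
  have h2 := natCast_half_add_self (h := h)
  simp only [sum_add, sum_singleton, insert_eq_cons, sum_cons, zero_add, mem_cons,
    mem_singleton] at hs ha ⊢
  rcases ha with rfl | rfl
  · linear_combination -hs - h2
  · linear_combination -hs

theorem isAtomSeq_of_even (hh : 2 ≤ h) :
    IsAtomSeq (dihedralSeq (replicate (3 * h - 2) 1) {0, (h : ZMod (2 * h))}) := by
  have h2 := natCast_half_add_self (h := h)
  have hT : ({0, (h : ZMod (2 * h))} : Multiset (ZMod (2 * h))) ≠ 0 := by simp
  have key : ∀ R₁ R₂ : Multiset (ZMod (2 * h)), R₁ + R₂ = replicate (3 * h - 2) 1 →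
      IsProductOne (dihedralSeq R₁ 0) → IsProductOne (dihedralSeq R₂ {0, (h : ZMod (2 * h))}) →
      R₁ = 0 := by
    intro R₁ R₂ hR h₁ h₂
    obtain ⟨a, b, hab, rfl, rfl⟩ : ∃ a b : ℕ, a + b = 3 * h - 2 ∧ R₁ = replicate a 1 ∧
        R₂ = replicate b 1 := exists_replicate_of_add_eq_replicate hR
    rw [isProductOne_rotations, sum_replicate, nsmul_one, ZMod.natCast_eq_zero_iff] at h₁
    obtain ⟨x, hx, y, hy, hxy⟩ := (isProductOne_dihedralSeq hT).1 h₂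
    obtain ⟨p, q, hpq, rfl⟩ := exists_eq_sub_of_mem_signedValues_replicate hx
    obtain rfl := eq_half_of_mem_balancedValues hy
    have hdvd : ((2 * h : ℕ) : ℤ) ∣ (p : ℤ) - q + h := by
      rw [← ZMod.intCast_zmod_eq_zero_iff_dvd]
      simpa using hxy
    obtain ⟨c, rfl⟩ := h₁
    by_contra hc
    have hc0 : 1 ≤ c := Nat.one_le_iff_ne_zero.2 fun h0 => hc (by simp [h0])
    have := Nat.mul_le_mul_left (2 * h) hc0
    have hle := Int.le_of_dvd (by omega) hdvd
    omega
  refine isAtomSeq_dihedralSeq.2 ⟨by simp, ?_, ?_⟩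
  · rw [isProductOne_dihedralSeq hT]
    refine ⟨h, ⟨replicate (2 * h - 1) 1, replicate (h - 1) 1, ?_, ?_⟩, h,
      ⟨{(h : ZMod (2 * h))}, {0}, add_comm _ _, rfl, by simp⟩, h2⟩
    · rw [← replicate_add]
      congr 1
      omega
    · simp only [sum_replicate, nsmul_one]
      rw [eq_sub_iff_add_eq, ← Nat.cast_add]
      congr 1
      omega
  · intro R₁ R₂ T₁ T₂ hR hTT h₁ h₂
    have hc := congrArg card hTT
    rw [card_add, card_pair] at hc
    obtain ⟨-, -, A, B, -, hAB, -, hcAB, -⟩ := exists_signs_of_isProductOne h₁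
    have hcA := congrArg card hAB
    rw [card_add] at hcA
    by_cases h0 : card T₁ = 0
    · obtain rfl := card_eq_zero.1 h0
      rw [zero_add] at hTT
      subst hTT
      exact Or.inl ⟨key R₁ R₂ hR h₁ h₂, rfl⟩
    · obtain rfl := card_eq_zero.1 (show card T₂ = 0 by omega)
      rw [add_zero] at hTT
      subst hTT
      exact Or.inr ⟨key R₂ R₁ (by rw [add_comm, hR]) h₂ h₁, rfl⟩

theorem exists_mem_LSystem_of_even (hh : 2 ≤ h) :
    ∃ L ∈ LSystem (DihedralGroup (2 * h)), 2 ∈ L ∧ 3 * h ∈ L := by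
  have hatom := isAtomSeq_of_even hh
  have hmem := two_mem_lengths_add hatom hatom.map_inv
  refine ⟨_, ⟨_, isProductOne_of_mem_lengths hmem, rfl⟩, hmem, ?_⟩
  have : Fact (1 < 2 * h) := ⟨by omega⟩
  convert card_mem_lengths_add_inv ?_ using 1
  · rw [card_dihedralSeq, card_replicate, card_pair]
    omega
  · simp only [dihedralSeq, map_replicate, insert_eq_cons, map_cons, map_singleton, mem_add,
      mem_replicate, mem_cons, mem_singleton, one_ne_sr, or_false, not_and]
    rw [one_def, r.injEq]
    simp

end Even

end Constructions

section Extremal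

open DihedralGroup Multiset

variable {m : ℕ}

theorem exists_eq_pair_inv {G : Type*} [Group G] {W : Multiset G} (hW : IsProductOne W)
    (hcard : card W = 2) : ∃ g : G, W = {g, g⁻¹} := by
  obtain ⟨l, rfl, hl⟩ := hW
  obtain ⟨a, b, rfl⟩ := List.length_eq_two.1 hcard
  obtain rfl : b = a⁻¹ := eq_inv_of_mul_eq_one_right (by simpa using hl)
  exact ⟨a, rfl⟩

theorem card_eq_two_of_card_sum {α : Type*} {f : Multiset (Multiset α)}
    (hf : ∀ W ∈ f, 2 ≤ card W) (hsum : card f.sum ≤ 2 * card f) {W : Multiset α} (hW : W ∈ f) :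
    card W = 2 := by
  obtain ⟨f, rfl⟩ := exists_cons_of_mem hW
  have h1 := two_mul_card_le_card_sum fun W hW => hf W (mem_cons_of_mem hW)
  have h2 := hf W hW
  rw [sum_cons, card_add, card_cons] at hsum
  omega

theorem exists_eq_map_pair [NeZero m] {f : Multiset (Multiset (DihedralGroup m))}
    (hf : ∀ W ∈ f, ∃ g : DihedralGroup m, W = {g, g⁻¹}) :
    ∃ C S : Multiset (ZMod m), (∀ x ∈ C, x.val ≤ (-x).val) ∧
      f = C.map (fun x => dihedralSeq {x, -x} 0) + S.map (fun y => dihedralSeq 0 {y, y}) := by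
  induction f using Multiset.induction_on with
  | empty => exact ⟨0, 0, by simp, by simp⟩
  | cons W f ih =>
    obtain ⟨C, S, hC, rfl⟩ := ih fun W hW => hf W (mem_cons_of_mem hW)
    obtain ⟨g, rfl⟩ := hf W (mem_cons_self W _)
    rcases g with x | y
    · rcases le_total x.val (-x).val with hx | hx
      · exact ⟨x ::ₘ C, S, by simpa [hx] using hC, by simp [dihedralSeq]⟩
      · refine ⟨(-x) ::ₘ C, S, by simpa [hx] using hC, ?_⟩
        simp [dihedralSeq, pair_comm (r x) (r (-x))]
    · exact ⟨C, y ::ₘ S, hC, by simp [dihedralSeq]⟩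

theorem sum_map_pair (C S : Multiset (ZMod m)) :
    (C.map (fun x => dihedralSeq {x, -x} 0) + S.map (fun y => dihedralSeq 0 {y, y})).sum =
      dihedralSeq (C + C.map (-·)) (S + S) := by
  have hC : (C.map (fun x => dihedralSeq {x, -x} 0)).sum = dihedralSeq (C + C.map (-·)) 0 := by
    induction C using Multiset.induction_on with
    | empty => simp [dihedralSeq]
    | cons x C ih =>
      rw [map_cons, map_cons, sum_cons, ih, ← dihedralSeq_add]
      simp only [insert_eq_cons, ← singleton_add, add_zero]
      congr 1
      abel
  have hS : (S.map (fun y => dihedralSeq 0 {y, y})).sum = dihedralSeq 0 (S + S) := by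
    induction S using Multiset.induction_on with
    | empty => simp [dihedralSeq]
    | cons x C ih =>
      rw [map_cons, sum_cons, ih, ← dihedralSeq_add]
      simp only [insert_eq_cons, ← singleton_add, add_zero]
      congr 1
      abel
  rw [sum_add, hC, hS, ← dihedralSeq_add, add_zero, zero_add]

theorem exists_isAtomSeq_rotations [NeZero m] {C : Multiset (ZMod m)} (hC : m ≤ card C) :
    ∃ I ≤ C, IsAtomSeq (dihedralSeq I 0) := by
  obtain ⟨I₀, hI₀⟩ := exists_zero_sum (R := C) (by rwa [Nat.card_zmod])
  obtain ⟨I, ⟨hI, hI0, hsum⟩, hmin⟩ := WellFounded.has_min (wellFounded_lt (α := Multiset (ZMod m)))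
    {I | I ≤ C ∧ I ≠ 0 ∧ I.sum = 0} ⟨I₀, hI₀⟩
  refine ⟨I, hI, isAtomSeq_dihedralSeq.2 ⟨by simpa using hI0, isProductOne_rotations.2 hsum, ?_⟩⟩
  rintro R₁ R₂ T₁ T₂ rfl hT h₁ -
  obtain ⟨rfl, rfl⟩ := add_eq_zero.1 hT
  rw [isProductOne_rotations] at h₁
  by_contra! hne
  have h1 : R₁ ≠ 0 := fun h => hne.1 h rfl
  have h2 : R₂ ≠ 0 := fun h => hne.2 h rfl
  exact hmin R₁ ⟨(le_add_right R₁ R₂).trans hI, h1, h₁⟩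
    (lt_of_le_of_ne (le_add_right R₁ R₂) fun h => h2 (by simpa using h))

theorem IsAtomSeq.not_pair_le {R T : Multiset (ZMod m)} (hA : IsAtomSeq (dihedralSeq R T))
    (hT : T ≠ 0) {x : ZMod m} (hx : x + x = 0) : ¬replicate 2 x ≤ R := by
  intro hle
  obtain ⟨R, rfl⟩ := Multiset.le_iff_exists_add.1 hle
  obtain ⟨-, hPO, hatom⟩ := isAtomSeq_dihedralSeq.1 hA
  obtain ⟨z, hz, y, hy, hzy⟩ := (isProductOne_dihedralSeq hT).1 hPO
  obtain ⟨v, hv, hmem⟩ := exists_sub_mem_of_mem_signedValues_add (H := ⊥) (R := replicate 2 x)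
    (fun g hg => by rw [eq_of_mem_replicate hg, hx]; exact zero_mem _) hz
  have hsum : (replicate 2 x).sum = 0 := by simpa [two_mul] using hx
  rw [AddSubgroup.mem_bot, hsum, sub_zero, sub_eq_zero] at hmem
  subst hmem
  rcases hatom _ R 0 T rfl (zero_add T) (isProductOne_rotations.2 hsum)
    ((isProductOne_dihedralSeq hT).2 ⟨z, hv, y, hy, hzy⟩) with h | h
  · simpa using h.1
  · exact hT h.2

theorem pair_notMem_LSystem_of_even {h n : ℕ} (hh : 2 ≤ h) (hn : 3 * h ≤ 2 * n) :
    ({2, 2 * n} : Set ℕ) ∉ LSystem (DihedralGroup (2 * h)) := by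
  rintro ⟨A, -, hL⟩
  have : NeZero (2 * h) := ⟨by omega⟩
  have h2n : 2 * n ∈ lengths A := hL ▸ by simp
  obtain ⟨U, V, hU, hV, hA, f, hcard, hf, hfA, hf2⟩ :=
    exists_atoms_of_two_mem_lengths (hL ▸ by simp) h2n (by omega)
  obtain ⟨R, T, rfl⟩ := exists_eq_dihedralSeq U
  obtain ⟨R', T', rfl⟩ := exists_eq_dihedralSeq V
  have hUc := hU.two_mul_card_le ⟨h, rfl⟩
  have hVc := hV.two_mul_card_le ⟨h, rfl⟩
  have hfc := two_mul_card_le_card_sum hf2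
  have hAc := congrArg card hA
  rw [hfA] at hfc
  rw [card_add, card_dihedralSeq, card_dihedralSeq] at hAc
  have hT : card T = 2 := hUc.2 (by omega)
  have hT' : card T' = 2 := hVc.2 (by omega)
  obtain ⟨C, S, hC, rfl⟩ := exists_eq_map_pair (f := f) fun W hW => exists_eq_pair_inv (hf W hW).2.1
    (card_eq_two_of_card_sum hf2 (by rw [hfA]; omega) hW)
  rw [card_add, card_map, card_map] at hcard
  rw [hA, sum_map_pair, ← dihedralSeq_add, dihedralSeq_inj] at hfA
  have hSc := congrArg card hfA.2
  rw [card_add, card_add] at hSc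
  obtain ⟨I, hI, hIatom⟩ := exists_isAtomSeq_rotations (C := C) (by omega)
  have hIm := hIatom.card_le_of_rotations
  have hI' : IsAtomSeq (dihedralSeq (I.map (-·)) 0) := by
    simpa [dihedralSeq, Function.comp_def] using hIatom.map_inv
  obtain ⟨C', rfl⟩ := Multiset.le_iff_exists_add.1 hI
  have hlen : 2 + card C' + card S ∈ lengths A := by
    refine mem_lengths_iff.2 ⟨{dihedralSeq I 0, dihedralSeq (I.map (-·)) 0} +
      (C'.map (fun x => dihedralSeq {x, -x} 0) + S.map (fun y => dihedralSeq 0 {y, y})), ?_, ?_, ?_⟩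
    · rw [card_add, card_add, card_map, card_map, card_pair, add_assoc]
    · intro W hW
      rcases mem_add.1 hW with hW | hW
      · rcases mem_cons.1 hW with rfl | hW
        · exact hIatom
        · rw [mem_singleton.1 hW]
          exact hI'
      · refine hf W (mem_of_le ?_ hW)
        rw [Multiset.map_add, add_assoc]
        exact le_add_left _ _
    · rw [sum_add, sum_map_pair, hA, ← dihedralSeq_add, ← hfA.1, ← hfA.2, insert_eq_cons, sum_cons,
        sum_singleton, ← dihedralSeq_add, ← dihedralSeq_add, Multiset.map_add]
      congr 1 <;> abel
  rw [← hL, Set.mem_insert_iff, Set.mem_singleton_iff] at hlen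
  rw [card_add] at hcard
  obtain ⟨x, y, rfl⟩ := card_eq_two.1 (show card I = 2 by omega)
  have hxy : x + y = 0 := by simpa using isProductOne_rotations.1 hIatom.2.1
  obtain rfl : y = -x := (neg_eq_of_add_eq_zero_right hxy).symm
  have hval : x.val = (-x).val := le_antisymm (hC x (by simp)) (by simpa using hC (-x) (by simp))
  have hx : -x = x := (ZMod.val_injective _ hval).symm
  have hxx : x + x = 0 := by rwa [hx] at hxy
  have hR : 4 ≤ count x (R + R') := by
    rw [← hfA.1]
    simp [hx]
  rw [count_add] at hR
  have h1 := mt le_count_iff_replicate_le.1 (hU.not_pair_le (by rintro rfl; simp at hT) hxx)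
  have h2 := mt le_count_iff_replicate_le.1 (hV.not_pair_le (by rintro rfl; simp at hT') hxx)
  omega

theorem le_of_pair_mem_LSystem {n : ℕ} [NeZero m] (hn : 3 ≤ n)
    (h : ({2, 2 * n} : Set ℕ) ∈ LSystem (DihedralGroup m)) : n ≤ m := by
  obtain ⟨A, -, hL⟩ := h
  have := le_card_of_mem_lengths (A := A) (k := 2 * n) (hL ▸ by simp) (hL ▸ by simp) (by omega)
  rw [DihedralGroup.nat_card] at this
  omega

end Extremal

end ProductOne

open ProductOne in
/-- Let `n ≥ 3` be odd and `m ≥ 3` with `m ≠ n`. Then the systems of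
sets of lengths of `B(D_{2n})` and `B(D_{2m})` are distinct. -/
theorem lsystem_dihedral_ne (n m : ℕ) (hn : 3 ≤ n) (hodd : Odd n) (hm : 3 ≤ m)
    (hne : m ≠ n) :
    LSystem (DihedralGroup n) ≠ LSystem (DihedralGroup m) := by
  intro heq
  have : NeZero n := ⟨by omega⟩
  have : NeZero m := ⟨by omega⟩
  have hpair := pair_mem_LSystem_of_odd hn hodd
  rw [heq] at hpair
  rcases Nat.even_or_odd' m with ⟨h, rfl | rfl⟩
  · obtain ⟨L, hL, h2, h3⟩ := exists_mem_LSystem_of_even (h := h) (by omega)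
    rw [← heq] at hL
    obtain ⟨A, -, rfl⟩ := hL
    have hle := le_card_of_mem_lengths h2 h3 (by omega)
    rw [DihedralGroup.nat_card] at hle
    exact pair_notMem_LSystem_of_even (by omega) hle hpair
  · have hpair' := pair_mem_LSystem_of_odd hm ⟨h, rfl⟩
    rw [← heq] at hpair'
    exact hne (le_antisymm (le_of_pair_mem_LSystem hm hpair') (le_of_pair_mem_LSystem hn hpair))
end

section
/- Let G be a finite group with |G| > 1. If G is an elementary abelian 2-group, or G has a subgroup G_0 that is a dihedral group of order 2n for some odd n ≥ 3 with D(G_0) = D(G), then K(G) = D(G)/2. Conversely, if G is nilpotent and K(G) = D(G)/2, then G is a 2-group, and moreover an elementary abelian 2-group if G is abelian. -/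
namespace ProductOne

variable {G : Type*} [Group G]

theorem exists_split {S : Multiset G} {x : G} {T : Multiset G} (hS : IsProductOne S)
    (h : S = x ::ₘ T) :
    ∃ l₁ l₂ : List G, ((l₁ ++ l₂ : List G) : Multiset G) = T ∧ l₁.prod * x * l₂.prod = 1 := by
  obtain ⟨l, hl, hp⟩ := hS
  have hx : x ∈ l := by
    rw [← Multiset.mem_coe, hl, h]
    exact Multiset.mem_cons_self x T
  obtain ⟨l₁, l₂, rfl⟩ := List.append_of_mem hx
  refine ⟨l₁, l₂, ?_, by simpa [mul_assoc] using hp⟩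
  have : (x ::ₘ ((l₁ ++ l₂ : List G) : Multiset G)) = x ::ₘ T := by
    rw [← h, ← hl, Multiset.cons_coe]
    exact Multiset.coe_eq_coe.2 List.perm_middle.symm
  exact (Multiset.cons_inj_right x).1 this

theorem isProductOne_singleton_one : IsProductOne ({1} : Multiset G) := ⟨[1], by simp, by simp⟩

theorem isAtomSeq_of_card_le_three {S : Multiset G} (h0 : S ≠ 0) (hS : IsProductOne S)
    (hc : Multiset.card S ≤ 3) (h1 : (1 : G) ∉ S) : IsAtomSeq S := by
  have key : ∀ A : Multiset G, A ≤ S → IsProductOne A → Multiset.card A ≤ 1 → A = 0 := by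
    intro A hle hA hcA
    by_contra hne
    have : Multiset.card A = 1 := by
      have := Multiset.card_pos.2 hne
      omega
    obtain ⟨g, rfl⟩ := Multiset.card_eq_one.1 this
    obtain rfl := eq_one_of_isProductOne_singleton hA
    exact h1 (Multiset.singleton_le.1 hle)
  refine ⟨h0, hS, fun A B hAB hA hB => ?_⟩
  have hcard : Multiset.card S = Multiset.card A + Multiset.card B := by simp [hAB]
  rcases le_or_gt (Multiset.card A) 1 with h | h
  · exact Or.inl (key A (hAB ▸ Multiset.le_add_right A B) hA h)
  · exact Or.inr (key B (hAB ▸ Multiset.le_add_left B A) hB (by omega))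

theorem isAtomSeq_singleton_one : IsAtomSeq ({1} : Multiset G) := by
  refine ⟨by simp, isProductOne_singleton_one, fun A B hAB _ _ => ?_⟩
  have hcard := congrArg Multiset.card hAB
  simp only [Multiset.card_singleton, Multiset.card_add] at hcard
  rw [← Multiset.card_eq_zero, ← Multiset.card_eq_zero]
  omega

theorem IsAtomSeq.eq_singleton_of_one_mem {S : Multiset G} (hS : IsAtomSeq S)
    (h1 : (1 : G) ∈ S) : S = {1} := by
  obtain ⟨T, rfl⟩ := Multiset.exists_cons_of_mem h1
  obtain ⟨l₁, l₂, hl, hp⟩ := exists_split hS.2.1 rfl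
  rcases hS.2.2 {1} T (by simp) isProductOne_singleton_one
    ⟨l₁ ++ l₂, hl, by simpa using hp⟩ with h | h
  · simp at h
  · simp [h]

theorem IsAtomSeq.card_le_natCard [Finite G] {S : Multiset G} (hS : IsAtomSeq S)
    (H : Subgroup G) (hH : ∀ g ∈ S, g ∈ H) : Multiset.card S ≤ Nat.card H := by
  obtain ⟨-, ⟨l, rfl, hp⟩, hmin⟩ := hS
  by_contra hlt
  simp only [Multiset.coe_card, not_le] at hlt
  have hmem : ∀ i : Fin l.length, (l.take i).prod ∈ H := fun i =>
    Subgroup.list_prod_mem H fun x hx => hH x (List.mem_of_mem_take hx)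
  have hninj : ¬ Function.Injective (fun i : Fin l.length => (⟨_, hmem i⟩ : H)) := fun hinj => by
    have := Nat.card_le_card_of_injective _ hinj
    rw [Nat.card_fin] at this
    omega
  obtain ⟨i, j, hij, hprod⟩ : ∃ i j : Fin l.length, i < j ∧
      (l.take i).prod = (l.take j).prod := by
    simp only [Function.Injective, not_forall] at hninj
    obtain ⟨i, j, h, hne⟩ := hninj
    have h' : (l.take i).prod = (l.take j).prod := by simpa using h
    rcases lt_or_gt_of_ne hne with h1 | h1
    · exact ⟨i, j, h1, h'⟩
    · exact ⟨j, i, h1, h'.symm⟩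
  have hij' : (i : ℕ) < j := hij
  have hj := j.2
  have htake : l.take j = l.take i ++ (l.drop i).take (j - i) := by
    rw [← List.take_add]
    congr 1
    omega
  have hA : ((l.drop i).take (j - i)).prod = 1 := by
    rw [htake, List.prod_append] at hprod
    exact left_eq_mul.1 hprod
  have hB : (l.take i ++ l.drop j).prod = 1 := by
    rw [List.prod_append, hprod, ← List.prod_append, List.take_append_drop, hp]
  have hsplit : (l : Multiset G) =
      ((l.drop i).take (j - i) : List G) + ((l.take i ++ l.drop j : List G) : Multiset G) := by
    conv_lhs => rw [← List.take_append_drop j l, htake]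
    simp only [← Multiset.coe_add]
    abel
  rcases hmin _ _ hsplit ⟨_, rfl, hA⟩ ⟨_, rfl, hB⟩ with h | h
  · have := congrArg Multiset.card h
    simp at this
    omega
  · have := congrArg Multiset.card h
    simp at this
    omega

theorem IsAtomSeq.card_le_davenport [Finite G] {S : Multiset G} (hS : IsAtomSeq S) :
    Multiset.card S ≤ Davenport G := by
  refine le_csSup ⟨Nat.card (⊤ : Subgroup G), ?_⟩ ⟨S, ⟨fun _ _ => Set.mem_univ _, hS⟩, rfl⟩
  rintro k ⟨T, hT, rfl⟩
  exact hT.2.card_le_natCard ⊤ fun _ _ => Subgroup.mem_top _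

theorem exists_isAtomSeq_card_eq_davenport [Finite G] :
    ∃ S : Multiset G, IsAtomSeq S ∧ Multiset.card S = Davenport G := by
  have hne : {k | ∃ S : Multiset G, IsAtomSeqOn Set.univ S ∧ Multiset.card S = k}.Nonempty :=
    ⟨1, {1}, ⟨fun _ _ => Set.mem_univ _, isAtomSeq_singleton_one⟩, by simp⟩
  obtain ⟨S, hS, hc⟩ := Nat.sSup_mem hne ⟨Nat.card (⊤ : Subgroup G), by
    rintro k ⟨T, hT, rfl⟩
    exact hT.2.card_le_natCard ⊤ fun _ _ => Subgroup.mem_top _⟩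
  exact ⟨S, hS.2, hc⟩

theorem davenportOn_le_natCard [Finite G] (H : Subgroup G) :
    DavenportOn (H : Set G) ≤ Nat.card H := by
  refine csSup_le ⟨1, {1}, ⟨?_, isAtomSeq_singleton_one⟩, by simp⟩ ?_
  · intro g hg
    rw [Multiset.mem_singleton.1 hg]
    exact H.one_mem
  · rintro k ⟨T, hT, rfl⟩
    exact hT.2.card_le_natCard H hT.1

theorem two_le_davenport [Finite G] (hG : 1 < Nat.card G) : 2 ≤ Davenport G := by
  have := Finite.one_lt_card_iff_nontrivial.1 hG
  obtain ⟨g, hg⟩ := exists_ne (1 : G)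
  have hatom : IsAtomSeq ({g, g⁻¹} : Multiset G) :=
    isAtomSeq_of_card_le_three (by simp) ⟨[g, g⁻¹], by simp; rfl, by simp⟩ (by simp)
      (by simp [hg, hg.symm])
  simpa using hatom.card_le_davenport

theorem three_le_davenport [Finite G] {g : G} (hg : g ^ 2 ≠ 1) : 3 ≤ Davenport G := by
  have hg1 : g ≠ 1 := by
    rintro rfl
    simp at hg
  have hatom : IsAtomSeq ({g, g, (g ^ 2)⁻¹} : Multiset G) := by
    refine isAtomSeq_of_card_le_three (by simp) ⟨[g, g, (g ^ 2)⁻¹], rfl, by simp [pow_two]⟩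
      (by simp) ?_
    simp [hg1.symm, hg]
  simpa using hatom.card_le_davenport

theorem crossNumber_cons (g : G) (S : Multiset G) :
    crossNumber (g ::ₘ S) = 1 / (orderOf g : ℚ) + crossNumber S := by
  simp [crossNumber]

theorem crossNumber_of_orderOf_eq_two {S : Multiset G} (h : ∀ g ∈ S, orderOf g = 2) :
    crossNumber S = (Multiset.card S : ℚ) / 2 := by
  induction S using Multiset.induction_on with
  | empty => simp [crossNumber]
  | cons g S ih =>
    rw [crossNumber_cons, ih fun x hx => h x (Multiset.mem_cons_of_mem hx),
      h g (Multiset.mem_cons_self g S)]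
    push_cast [Multiset.card_cons]
    ring

theorem two_le_orderOf [Finite G] {g : G} (hg : g ≠ 1) : 2 ≤ orderOf g := by
  have h0 := orderOf_pos g
  have h1 : orderOf g ≠ 1 := by rwa [Ne, orderOf_eq_one_iff]
  omega

theorem crossNumber_le [Finite G] {S : Multiset G} (h : (1 : G) ∉ S) :
    crossNumber S ≤ (Multiset.card S : ℚ) / 2 := by
  induction S using Multiset.induction_on with
  | empty => simp [crossNumber]
  | cons g S ih =>
    simp only [Multiset.mem_cons, not_or] at h
    have hg : (2 : ℚ) ≤ orderOf g := by exact_mod_cast two_le_orderOf (Ne.symm h.1)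
    have := one_div_le_one_div_of_le two_pos hg
    have := ih h.2
    rw [crossNumber_cons]
    push_cast [Multiset.card_cons]
    linarith

theorem orderOf_eq_two_of_le_crossNumber [Finite G] {S : Multiset G} (h : (1 : G) ∉ S)
    (hS : (Multiset.card S : ℚ) / 2 ≤ crossNumber S) : ∀ g ∈ S, orderOf g = 2 := by
  intro g hg
  obtain ⟨T, rfl⟩ := Multiset.exists_cons_of_mem hg
  simp only [Multiset.mem_cons, not_or] at h
  by_contra hne
  have h2 := two_le_orderOf (Ne.symm h.1)
  have h3 : (3 : ℚ) ≤ orderOf g := by exact_mod_cast (by omega : 3 ≤ orderOf g)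
  have h4 := one_div_le_one_div_of_le (by norm_num) h3
  have h5 := crossNumber_le h.2
  rw [crossNumber_cons] at hS
  push_cast [Multiset.card_cons] at hS
  linarith

theorem IsAtomSeq.crossNumber_le_davenport [Finite G] (hG : 1 < Nat.card G) {S : Multiset G}
    (hS : IsAtomSeq S) : crossNumber S ≤ (Davenport G : ℚ) / 2 := by
  by_cases h1 : (1 : G) ∈ S
  · have h2 : (2 : ℚ) ≤ Davenport G := by exact_mod_cast two_le_davenport hG
    rw [hS.eq_singleton_of_one_mem h1]
    simp only [crossNumber, Multiset.map_singleton, Multiset.sum_singleton, orderOf_one]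
    push_cast
    linarith
  · have h2 : (Multiset.card S : ℚ) ≤ Davenport G := by exact_mod_cast hS.card_le_davenport
    linarith [crossNumber_le h1]

theorem isGreatest_of_involutions [Finite G] (hG : 1 < Nat.card G) {S : Multiset G}
    (hS : IsAtomSeq S) (hc : Multiset.card S = Davenport G) (h2 : ∀ g ∈ S, orderOf g = 2) :
    IsGreatest {q : ℚ | ∃ S : Multiset G, IsAtomSeq S ∧ q = crossNumber S}
      ((Davenport G : ℚ) / 2) := by
  refine ⟨⟨S, hS, by rw [crossNumber_of_orderOf_eq_two h2, hc]⟩, ?_⟩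
  rintro q ⟨T, hT, rfl⟩
  exact hT.crossNumber_le_davenport hG

/-! ### Dihedral groups -/

/-- The shape of a product of `a` copies of `sr 0` and `b` copies of `sr 1`, in any order. -/
theorem dihedral_prod_shape {n : ℕ} (l : List (DihedralGroup n))
    (hl : ∀ x ∈ l, x = .sr 0 ∨ x = .sr 1) :
    ∃ (a b : ℕ) (c : ℤ),
      (l : Multiset (DihedralGroup n)) =
        Multiset.replicate a (.sr 0) + Multiset.replicate b (.sr 1) ∧
      Even (c - b) ∧ -b ≤ c ∧ c ≤ b ∧
      (Even (a + b) ∧ l.prod = .r c ∧ -a ≤ c ∧ c ≤ a ∨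
        Odd (a + b) ∧ l.prod = .sr c ∧ 1 - a ≤ c ∧ c ≤ a + 1) := by
  induction l with
  | nil => exact ⟨0, 0, 0, by simp⟩
  | cons x l ih =>
    obtain ⟨a, b, c, hS, hcb, h1, h2, h3⟩ := ih fun y hy => hl y (List.mem_cons_of_mem x hy)
    rcases hl x List.mem_cons_self with rfl | rfl
    · rcases h3 with ⟨hab, hp, h4, h5⟩ | ⟨hab, hp, h4, h5⟩
      · refine ⟨a + 1, b, c, ?_, hcb, h1, h2, Or.inr ⟨by grind, ?_, by grind, by grind⟩⟩
        · rw [← Multiset.cons_coe, hS, Multiset.replicate_succ, Multiset.cons_add]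
        · simp [hp]
      · refine ⟨a + 1, b, c, ?_, hcb, h1, h2, Or.inl ⟨by grind, ?_, by grind, by grind⟩⟩
        · rw [← Multiset.cons_coe, hS, Multiset.replicate_succ, Multiset.cons_add]
        · simp [hp]
    · rcases h3 with ⟨hab, hp, h4, h5⟩ | ⟨hab, hp, h4, h5⟩
      · refine ⟨a, b + 1, c + 1, ?_, by grind, by grind, by grind,
          Or.inr ⟨by grind, ?_, by grind, by grind⟩⟩
        · rw [← Multiset.cons_coe, hS, Multiset.replicate_succ, Multiset.add_cons]
        · simp [hp, add_comm]
      · refine ⟨a, b + 1, c - 1, ?_, by grind, by grind, by grind,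
          Or.inl ⟨by grind, ?_, by grind, by grind⟩⟩
        · rw [← Multiset.cons_coe, hS, Multiset.replicate_succ, Multiset.add_cons]
        · simp [hp]

theorem dihedral_isProductOne_shape {n : ℕ} {A : Multiset (DihedralGroup n)}
    (hA : IsProductOne A) (hl : ∀ x ∈ A, x = .sr 0 ∨ x = .sr 1) :
    ∃ a b : ℕ, A = Multiset.replicate a (.sr 0) + Multiset.replicate b (.sr 1) ∧
      (Even a ∨ n ≤ a ∧ n ≤ b) := by
  obtain ⟨l, rfl, hp⟩ := hA
  obtain ⟨a, b, c, hS, hcb, h1, h2, ⟨hab, hp', h4, h5⟩ | ⟨hab, hp', h4, h5⟩⟩ :=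
    dihedral_prod_shape l hl
  · refine ⟨a, b, hS, ?_⟩
    rw [hp, DihedralGroup.one_def, DihedralGroup.r.injEq] at hp'
    have hdvd := (ZMod.intCast_zmod_eq_zero_iff_dvd c n).1 hp'.symm
    by_cases hc : c = 0
    · subst hc
      left
      grind
    · right
      have := Int.le_of_dvd (abs_pos.2 hc) ((dvd_abs _ _).2 hdvd)
      grind
  · rw [hp, DihedralGroup.one_def] at hp'
    cases hp'

theorem isProductOne_replicate_add {g h : G} {m : ℕ} (hm : (g * h) ^ m = 1) :
    IsProductOne (Multiset.replicate m g + Multiset.replicate m h) := by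
  have key : ∀ k : ℕ, ∃ l : List G,
      (l : Multiset G) = Multiset.replicate k g + Multiset.replicate k h ∧
        l.prod = (g * h) ^ k := by
    intro k
    induction k with
    | zero => exact ⟨[], by simp⟩
    | succ k ih =>
      obtain ⟨l, hl, hp⟩ := ih
      refine ⟨g :: h :: l, ?_, by simp [hp, pow_succ', mul_assoc]⟩
      rw [← Multiset.cons_coe, ← Multiset.cons_coe, hl, Multiset.replicate_succ,
        Multiset.replicate_succ, Multiset.cons_add, Multiset.add_cons]
  obtain ⟨l, hl, hp⟩ := key m
  exact ⟨l, hl, hp.trans hm⟩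

theorem dihedral_sr_zero_ne_sr_one {n : ℕ} (hn : 3 ≤ n) :
    (DihedralGroup.sr 0 : DihedralGroup n) ≠ .sr 1 := by
  have : Fact (1 < n) := ⟨by omega⟩
  simp

theorem dihedral_isAtomSeq {n : ℕ} (hn : Odd n) (h3 : 3 ≤ n) :
    IsAtomSeq (Multiset.replicate n (.sr 0 : DihedralGroup n) + Multiset.replicate n (.sr 1)) := by
  classical
  refine ⟨?_, isProductOne_replicate_add (by simp), fun A B hAB hA hB => ?_⟩
  · intro h
    have := congrArg Multiset.card h
    simp at this
    omega
  have hmem : ∀ x ∈ A + B, x = .sr 0 ∨ x = .sr 1 := by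
    intro x hx
    rw [← hAB, Multiset.mem_add] at hx
    exact hx.imp Multiset.eq_of_mem_replicate Multiset.eq_of_mem_replicate
  obtain ⟨a, b, rfl, h1⟩ := dihedral_isProductOne_shape hA fun x hx =>
    hmem x (Multiset.mem_add.2 (Or.inl hx))
  obtain ⟨a', b', rfl, h2⟩ := dihedral_isProductOne_shape hB fun x hx =>
    hmem x (Multiset.mem_add.2 (Or.inr hx))
  have hne := dihedral_sr_zero_ne_sr_one h3
  have e1 := congrArg (Multiset.count (.sr 0)) hAB
  have e2 := congrArg (Multiset.count (.sr 1)) hAB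
  simp only [Multiset.count_add, Multiset.count_replicate, hne, hne.symm, if_true, if_false]
    at e1 e2
  rw [← Multiset.card_eq_zero, ← Multiset.card_eq_zero]
  simp only [Multiset.card_add, Multiset.card_replicate]
  grind

theorem isProductOne_of_map {H : Type*} [Group H] {f : H →* G} (hf : Function.Injective f)
    {S : Multiset H} (h : IsProductOne (S.map f)) : IsProductOne S := by
  obtain ⟨l, hl, hp⟩ := h
  obtain ⟨m, rfl⟩ : l ∈ Set.range (List.map f) := by
    rw [Set.range_list_map]
    intro x hx
    rw [← Multiset.mem_coe, hl, Multiset.mem_map] at hx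
    obtain ⟨y, -, rfl⟩ := hx
    exact ⟨y, rfl⟩
  refine ⟨m, Multiset.map_injective hf (by simpa using hl), hf ?_⟩
  rw [map_list_prod, hp, map_one]

theorem IsAtomSeq.map {H : Type*} [Group H] {f : H →* G} (hf : Function.Injective f)
    {S : Multiset H} (h : IsAtomSeq S) : IsAtomSeq (S.map f) := by
  refine ⟨by simpa using h.1, ?_, fun A B hAB hA hB => ?_⟩
  · obtain ⟨l, rfl, hp⟩ := h.2.1
    exact ⟨l.map f, by simp, by rw [← map_list_prod, hp, map_one]⟩
  · have lift : ∀ C : Multiset G, C ≤ S.map f → ∃ D : Multiset H, D.map f = C := by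
      intro C hC
      have hr : ∀ x ∈ C, ∃ y, f y = x := fun x hx => by
        obtain ⟨y, -, hy⟩ := Multiset.mem_map.1 (Multiset.mem_of_le hC hx)
        exact ⟨y, hy⟩
      have : CanLift G H f (fun x => ∃ y, f y = x) := ⟨fun x hx => hx⟩
      lift C to Multiset H using hr
      exact ⟨C, rfl⟩
    obtain ⟨A, rfl⟩ := lift A (hAB ▸ Multiset.le_add_right _ _)
    obtain ⟨B, rfl⟩ := lift B (hAB ▸ Multiset.le_add_left _ _)
    rw [← Multiset.map_add] at hAB
    simpa using h.2.2 A B (Multiset.map_injective hf hAB) (isProductOne_of_map hf hA)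
      (isProductOne_of_map hf hB)

theorem isGreatest_of_dihedral [Finite G] (hG : 1 < Nat.card G) {G₀ : Subgroup G} {n : ℕ}
    (hn : Odd n) (h3 : 3 ≤ n) (e : G₀ ≃* DihedralGroup n)
    (hD : DavenportOn (G₀ : Set G) = Davenport G) :
    IsGreatest {q : ℚ | ∃ S : Multiset G, IsAtomSeq S ∧ q = crossNumber S}
      ((Davenport G : ℚ) / 2) := by
  let f : DihedralGroup n →* G := G₀.subtype.comp e.symm.toMonoidHom
  have hf : Function.Injective f := G₀.subtype_injective.comp e.symm.injective
  have hatom := (dihedral_isAtomSeq hn h3).map hf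
  refine isGreatest_of_involutions hG hatom (le_antisymm hatom.card_le_davenport ?_) ?_
  · have h1 := davenportOn_le_natCard G₀
    rw [hD, Nat.card_congr e.toEquiv, DihedralGroup.nat_card] at h1
    simp only [Multiset.card_map, Multiset.card_add, Multiset.card_replicate]
    omega
  · intro g hg
    obtain ⟨y, hy, rfl⟩ := Multiset.mem_map.1 hg
    rw [orderOf_injective f hf]
    rcases Multiset.mem_add.1 hy with h | h <;>
      rw [Multiset.eq_of_mem_replicate h, DihedralGroup.orderOf_sr]

/-! ### Nilpotent groups -/

theorem IsProductOne.of_commute {h x : G} {A : Multiset G} (hx : Commute h x)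
    (hA : ∀ y ∈ A, Commute h y) (hS : IsProductOne (h ::ₘ (h⁻¹ * x) ::ₘ A)) :
    IsProductOne (x ::ₘ A) := by
  obtain ⟨l₁, l₂, hl, hp⟩ := exists_split hS rfl
  have hmem : ∀ y ∈ l₁, Commute h y := fun y hy => by
    have : y ∈ (h⁻¹ * x) ::ₘ A := by
      rw [← hl]
      simp [hy]
    rcases Multiset.mem_cons.1 this with rfl | h'
    · exact ((Commute.refl h).inv_right).mul_right hx
    · exact hA y h'
  have hc₁ : Commute h l₁.prod := Commute.list_prod_right _ _ hmem
  have hp' : (l₁ ++ l₂).prod = h⁻¹ := by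
    rw [List.prod_append]
    exact eq_inv_of_mul_eq_one_right (by rw [← mul_assoc, hc₁.eq, hp])
  obtain ⟨x', hx', m₁, m₂, hm⟩ : ∃ x', x' = h⁻¹ * x ∧ ∃ m₁ m₂, l₁ ++ l₂ = m₁ ++ x' :: m₂ := by
    refine ⟨_, rfl, List.append_of_mem ?_⟩
    rw [← Multiset.mem_coe, hl]
    exact Multiset.mem_cons_self _ _
  subst hx'
  have hm' : ((m₁ ++ m₂ : List G) : Multiset G) = A := by
    apply (Multiset.cons_inj_right (h⁻¹ * x)).1
    rw [← hl, hm, Multiset.cons_coe]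
    exact Multiset.coe_eq_coe.2 List.perm_middle.symm
  have hc₂ : Commute h m₁.prod := Commute.list_prod_right _ _ fun y hy =>
    hA y (by rw [← hm']; simp [hy])
  refine ⟨m₁ ++ x :: m₂, ?_, ?_⟩
  · rw [← hm', Multiset.cons_coe]
    exact Multiset.coe_eq_coe.2 List.perm_middle
  · rw [hm] at hp'
    simp only [List.prod_append, List.prod_cons] at hp' ⊢
    have : h⁻¹ * (m₁.prod * (x * m₂.prod)) = h⁻¹ := by
      rw [← mul_assoc, hc₂.inv_left.eq, mul_assoc, ← mul_assoc h⁻¹, hp']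
    simpa using this

theorem IsProductOne.mem_of_cons {H : Subgroup G} {h : G} {A : Multiset G}
    (hA : ∀ y ∈ A, y ∈ H) (hS : IsProductOne (h ::ₘ A)) : h ∈ H := by
  obtain ⟨l₁, l₂, rfl, hp⟩ := exists_split hS rfl
  have h1 : l₁.prod ∈ H := H.list_prod_mem fun y hy => hA y (by simp [hy])
  have h2 : l₂.prod ∈ H := H.list_prod_mem fun y hy => hA y (by simp [hy])
  rw [← H.mul_mem_cancel_left h1, ← H.mul_mem_cancel_right h2, hp]
  exact H.one_mem

/-- An atom over a subgroup `H` becomes longer by splitting a term `x` into `h` and `h⁻¹ * x`,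
where `h ∉ H` commutes with all terms. -/
theorem IsAtomSeq.split_cons {H : Subgroup G} {h x : G} {T : Multiset G}
    (hS : IsAtomSeq (x ::ₘ T)) (hH : ∀ y ∈ x ::ₘ T, y ∈ H)
    (hcomm : ∀ y ∈ x ::ₘ T, Commute h y) (hh : h ∉ H) :
    IsAtomSeq (h ::ₘ (h⁻¹ * x) ::ₘ T) := by
  have hxH := hH x (Multiset.mem_cons_self x T)
  have hTH : ∀ y ∈ T, y ∈ H := fun y hy => hH y (Multiset.mem_cons_of_mem hy)
  have hx := hcomm x (Multiset.mem_cons_self x T)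
  have hT : ∀ y ∈ T, Commute h y := fun y hy => hcomm y (Multiset.mem_cons_of_mem hy)
  have key : ∀ A B : Multiset G, h ::ₘ (h⁻¹ * x) ::ₘ T = A + B → IsProductOne A →
      IsProductOne B → h ∈ A → B = 0 := by
    intro A B hAB hA hB hhA
    obtain ⟨A, rfl⟩ := Multiset.exists_cons_of_mem hhA
    rw [Multiset.cons_add, Multiset.cons_inj_right] at hAB
    have hmem : h⁻¹ * x ∈ A + B := hAB ▸ Multiset.mem_cons_self _ _
    rcases Multiset.mem_add.1 hmem with hm | hm
    · obtain ⟨A, rfl⟩ := Multiset.exists_cons_of_mem hm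
      rw [Multiset.cons_add, Multiset.cons_inj_right] at hAB
      subst hAB
      have hA' := hA.of_commute hx fun y hy => hT y (Multiset.mem_add.2 (Or.inl hy))
      refine (hS.2.2 (x ::ₘ A) B (by rw [Multiset.cons_add]) hA' hB).resolve_left ?_
      exact Multiset.cons_ne_zero
    · obtain ⟨B, rfl⟩ := Multiset.exists_cons_of_mem hm
      rw [Multiset.add_cons, Multiset.cons_inj_right] at hAB
      subst hAB
      exact absurd (hA.mem_of_cons fun y hy => hTH y (Multiset.mem_add.2 (Or.inl hy))) hh
  refine ⟨Multiset.cons_ne_zero, ?_, fun A B hAB hA hB => ?_⟩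
  · obtain ⟨l₁, l₂, hl, hp⟩ := exists_split hS.2.1 rfl
    refine ⟨l₁ ++ h :: (h⁻¹ * x) :: l₂, ?_, by simpa [mul_assoc] using hp⟩
    rw [← hl, Multiset.cons_coe, Multiset.cons_coe]
    exact Multiset.coe_eq_coe.2 (List.perm_middle.trans (List.perm_middle.cons h))
  · have hmem : h ∈ A + B := hAB ▸ Multiset.mem_cons_self _ _
    rcases Multiset.mem_add.1 hmem with hm | hm
    · exact Or.inr (key A B hAB hA hB hm)
    · exact Or.inl (key B A (by rw [hAB, add_comm]) hB hA hm)

/-- If the cross number of an atom is `D(G) / 2`, then an element commuting with all involutions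
lies in every subgroup containing all involutions. -/
theorem mem_of_commute_involutions [Finite G] {S : Multiset G}
    (hS : IsAtomSeq S) (hk : (Davenport G : ℚ) / 2 = crossNumber S) (hne : ∃ g : G, g ^ 2 ≠ 1)
    {H : Subgroup G} (hH : ∀ y : G, orderOf y = 2 → y ∈ H) {h : G}
    (hcomm : ∀ y : G, orderOf y = 2 → Commute h y) : h ∈ H := by
  have h1 : (1 : G) ∉ S := by
    intro h1
    obtain ⟨g, hg⟩ := hne
    have h3 : (3 : ℚ) ≤ Davenport G := by exact_mod_cast three_le_davenport hg
    rw [hS.eq_singleton_of_one_mem h1] at hk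
    simp only [crossNumber, Multiset.map_singleton, Multiset.sum_singleton, orderOf_one] at hk
    push_cast at hk
    linarith
  have hle : (Multiset.card S : ℚ) ≤ Davenport G := by exact_mod_cast hS.card_le_davenport
  have hk' := crossNumber_le h1
  have hord := orderOf_eq_two_of_le_crossNumber h1 (by linarith)
  have hcard : Multiset.card S = Davenport G := by
    have : (Multiset.card S : ℚ) = Davenport G := by linarith
    exact_mod_cast this
  by_contra hh
  obtain ⟨x, hx⟩ := Multiset.exists_mem_of_ne_zero hS.1
  obtain ⟨T, rfl⟩ := Multiset.exists_cons_of_mem hx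
  have := (hS.split_cons (fun y hy => hH y (hord y hy)) (fun y hy => hcomm y (hord y hy))
    hh).card_le_davenport
  rw [← hcard] at this
  simp at this

theorem pow_two_eq_one_of_commutative [Finite G] {S : Multiset G}
    (hS : IsAtomSeq S) (hk : (Davenport G : ℚ) / 2 = crossNumber S)
    (hcomm : ∀ a b : G, a * b = b * a) (g : G) : g ^ 2 = 1 := by
  by_contra hg
  let H : Subgroup G :=
    { carrier := {y | y ^ 2 = 1}
      one_mem' := one_pow 2
      mul_mem' := fun {a b} ha hb => by
        simp only [Set.mem_ofPred_eq] at ha hb ⊢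
        rw [Commute.mul_pow (hcomm a b), ha, hb, one_mul]
      inv_mem' := fun {a} ha => by
        simp only [Set.mem_ofPred_eq] at ha ⊢
        rw [inv_pow, ha, inv_one] }
  exact hg (mem_of_commute_involutions hS hk ⟨g, hg⟩ (H := H)
    (fun y hy => (hy ▸ pow_orderOf_eq_one y : y ^ 2 = 1)) fun y _ => hcomm g y)

theorem isPGroup_two_of_nilpotent [Finite G] [Group.IsNilpotent G] {S : Multiset G}
    (hS : IsAtomSeq S) (hk : (Davenport G : ℚ) / 2 = crossNumber S) : IsPGroup 2 G := by
  have : Fact (Nat.Prime 2) := ⟨Nat.prime_two⟩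
  have hnormal : ∀ (p : ℕ) (_ : Fact p.Prime) (P : Sylow p G), (P : Subgroup G).Normal :=
    (Group.isNilpotent_of_finite_tfae.out 0 3).1 ‹_›
  have hmem : ∀ (p : ℕ) (_ : Fact p.Prime) (P : Sylow p G) (y : G), orderOf y = p →
      y ∈ (P : Subgroup G) := by
    intro p hp P y hy
    have hz : IsPGroup p (Subgroup.zpowers y) :=
      IsPGroup.of_card (n := 1) (by rw [Nat.card_zpowers, hy, pow_one])
    obtain ⟨Q, hQ⟩ := hz.exists_le_sylow
    have := hnormal p hp P
    have := Sylow.unique_of_normal P this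
    rw [Subsingleton.elim P Q]
    exact hQ (Subgroup.mem_zpowers y)
  by_contra hnot
  obtain ⟨p, hp, hdvd, hp2⟩ : ∃ p, p.Prime ∧ p ∣ Nat.card G ∧ p ≠ 2 := by
    by_contra! hall
    exact hnot (IsPGroup.iff_card.2
      ⟨_, Nat.eq_prime_pow_of_unique_prime_dvd Nat.card_pos.ne' fun {d} hd hdd => hall d hd hdd⟩)
  have : Fact p.Prime := ⟨hp⟩
  obtain ⟨h, hh⟩ := exists_prime_orderOf_dvd_card' p hdvd
  obtain ⟨P⟩ := (inferInstance : Nonempty (Sylow 2 G))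
  obtain ⟨Q⟩ := (inferInstance : Nonempty (Sylow p G))
  have hdisj : Disjoint (P : Subgroup G) (Q : Subgroup G) :=
    IsPGroup.disjoint_of_ne 2 p hp2.symm _ _ P.isPGroup' Q.isPGroup'
  have hhQ := hmem p ‹_› Q h hh
  have hh1 : h ≠ 1 := by
    rintro rfl
    rw [orderOf_one] at hh
    exact hp.one_lt.ne hh
  have hhP : h ∈ (P : Subgroup G) := by
    refine mem_of_commute_involutions hS hk ⟨h, fun h2 => ?_⟩ (hmem 2 ‹_› P) fun y hy => ?_
    · have := orderOf_dvd_of_pow_eq_one h2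
      rw [hh] at this
      exact hp2 ((Nat.prime_dvd_prime_iff_eq hp Nat.prime_two).1 this)
    · exact Subgroup.commute_of_normal_of_disjoint _ _ (hnormal p ‹_› Q) (hnormal 2 ‹_› P)
        hdisj.symm h y hhQ (hmem 2 ‹_› P y hy)
  exact hh1 (Subgroup.disjoint_def.1 hdisj hhP hhQ)

end ProductOne

open ProductOne in
/-- Let `G` be a finite group with `|G| > 1`. If `G` is an elementary
abelian `2`-group, or `G` has a subgroup `G₀` which is dihedral of order `2n` for some odd
`n ≥ 3` with `D(G₀) = D(G)`, then `K(G) = D(G)/2`. Conversely, if `G` is nilpotent and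
`K(G) = D(G)/2`, then `G` is a `2`-group, and an elementary abelian `2`-group if `G` is
abelian. (Here `K(G) = D(G)/2` is expressed as: `D(G)/2` is the greatest element of the
set of cross numbers of atoms.) -/
theorem cross_number_eq_half_davenport (G : Type*) [Group G] [Finite G]
    (hG : 1 < Nat.card G) :
    (((∀ g : G, g ^ 2 = 1) ∨
        ∃ (G₀ : Subgroup G) (n : ℕ), Odd n ∧ 3 ≤ n ∧ Nonempty (G₀ ≃* DihedralGroup n) ∧
          DavenportOn (G₀ : Set G) = Davenport G) →
      IsGreatest {q : ℚ | ∃ S : Multiset G, IsAtomSeq S ∧ q = crossNumber S}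
        ((Davenport G : ℚ) / 2)) ∧
    ((Group.IsNilpotent G ∧
        IsGreatest {q : ℚ | ∃ S : Multiset G, IsAtomSeq S ∧ q = crossNumber S}
          ((Davenport G : ℚ) / 2)) →
      IsPGroup 2 G ∧ ((∀ a b : G, a * b = b * a) → ∀ g : G, g ^ 2 = 1)) := by
  constructor
  · rintro (h2 | ⟨G₀, n, hn, h3, ⟨e⟩, hD⟩)
    · obtain ⟨S, hS, hc⟩ := exists_isAtomSeq_card_eq_davenport (G := G)
      refine isGreatest_of_involutions hG hS hc fun g hg => orderOf_eq_prime (h2 g) ?_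
      rintro rfl
      have := two_le_davenport hG
      rw [← hc, hS.eq_singleton_of_one_mem hg, Multiset.card_singleton] at this
      omega
    · exact isGreatest_of_dihedral hG hn h3 e hD
  · rintro ⟨hnil, ⟨S, hS, hk⟩, -⟩
    exact ⟨isPGroup_two_of_nilpotent hS hk, pow_two_eq_one_of_commutative hS hk⟩
end
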